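/- Suppose that R is either a regular local ring or an analytically unramified Noetherian local domain, with algebraically closed residue field, of dimension d > 0. Let ω be a zero-dimensional rank one valuation of the quotient field of R which dominates R, with value group contained in ℝ. Let S^R(ω) = {ω(f) : f ∈ R, f ≠ 0, ω(f) > 0} be the semigroup of positive values attained on R, and for n ∈ ℤ_+ define φ(n) = #(S^R(ω) ∩ (0, n)). Then the limit lim_{n→∞} φ(n)/n^d exists (as a real number). -/

import Mathlib

open Filter Topology IsLocalRing

/-- A Noetherian local ring is regular if its maximal ideal can be generated by
`dim` elements. -/
def IsRegularLocalRing' (A : Type*) [CommRing A] [IsLocalRing A] : Prop :=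
  IsNoetherianRing A ∧ ∃ s : Finset A, Ideal.span (s : Set A) = IsLocalRing.maximalIdeal A ∧
    (s.card : WithBot ℕ∞) = ringKrullDim A

section Colength

variable {R : Type*} [CommRing R]

/-- The colength of an ideal: the length of the quotient module. -/
noncomputable def Ideal.colen (I : Ideal R) : ℕ∞ := Module.length R (R ⧸ I)

/-- The ideal of all `g` with `g * f ∈ I`. -/
def Ideal.colonElem (I : Ideal R) (f : R) : Ideal R :=
  Submodule.comap (LinearMap.toSpanSingleton R R f) I

theorem Ideal.mem_colonElem {I : Ideal R} {f g : R} : g ∈ I.colonElem f ↔ g * f ∈ I := by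
  simp [Ideal.colonElem]

theorem Ideal.colen_anti {I J : Ideal R} (h : I ≤ J) : J.colen ≤ I.colen :=
  Module.length_le_of_surjective (Submodule.factor h) (Submodule.factor_surjective h)

theorem Ideal.colen_top : (⊤ : Ideal R).colen = 0 := by
  unfold Ideal.colen
  rw [Module.length_eq_zero_iff]
  exact Submodule.Quotient.subsingleton_iff.2 rfl

theorem Ideal.colen_eq_add (I : Ideal R) (f : R) :
    I.colen = (I.colonElem f).colen + (I ⊔ Ideal.span {f}).colen := by
  have h2 : I ≤ I ⊔ Ideal.span {f} := le_sup_left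
  have hc : I.colonElem f ≤ Submodule.comap (LinearMap.toSpanSingleton R R f) I := fun _ hg => hg
  refine Module.length_eq_add_of_exact
    (Submodule.mapQ (I.colonElem f) I (LinearMap.toSpanSingleton R R f) hc)
    (Submodule.factor h2) ?_ (Submodule.factor_surjective h2) ?_
  · rw [← LinearMap.ker_eq_bot, Submodule.ker_mapQ]
    exact Submodule.mkQ_map_self _
  · intro y
    obtain ⟨y, rfl⟩ := Submodule.Quotient.mk_surjective _ y
    rw [← Submodule.mkQ_apply, Submodule.factor_mk, Submodule.mkQ_apply,
      Submodule.Quotient.mk_eq_zero]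
    constructor
    · intro hy
      obtain ⟨a, ha, b, hb, rfl⟩ := Submodule.mem_sup.1 hy
      obtain ⟨c, rfl⟩ := Ideal.mem_span_singleton'.1 hb
      refine ⟨Submodule.Quotient.mk c, ?_⟩
      rw [Submodule.mapQ_apply, Submodule.mkQ_apply, Submodule.Quotient.eq]
      simpa using ha
    · rintro ⟨z, hz⟩
      obtain ⟨z, rfl⟩ := Submodule.Quotient.mk_surjective _ z
      rw [Submodule.mapQ_apply, Submodule.mkQ_apply, Submodule.Quotient.eq] at hz
      have h3 : z * f ∈ Ideal.span {f} := Ideal.mem_span_singleton'.2 ⟨z, rfl⟩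
      have h4 := Ideal.sub_mem _ (Ideal.mem_sup_right h3 : z * f ∈ I ⊔ Ideal.span {f})
        (Ideal.mem_sup_left hz)
      simpa using h4

theorem Ideal.colen_le_sup_span_add {I J : Ideal R} {f : R} (h : ∀ y ∈ J, y * f ∈ I) :
    I.colen ≤ (I ⊔ Ideal.span {f}).colen + J.colen := by
  rw [I.colen_eq_add f, add_comm]
  gcongr
  exact Ideal.colen_anti fun y hy => Ideal.mem_colonElem.2 (h y hy)

theorem Ideal.one_le_colen {I : Ideal R} (h : I ≠ ⊤) : 1 ≤ I.colen := by
  unfold Ideal.colen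
  rw [Order.one_le_iff_pos, Module.length_pos_iff]
  exact Submodule.Quotient.nontrivial_iff.2 h

theorem Ideal.colen_sup_span_add_one_le {I : Ideal R} {f : R} (h : f ∉ I) :
    (I ⊔ Ideal.span {f}).colen + 1 ≤ I.colen := by
  rw [I.colen_eq_add f, add_comm]
  gcongr
  refine Ideal.one_le_colen fun h1 => h ?_
  have : (1 : R) ∈ I.colonElem f := by rw [h1]; trivial
  simpa [Ideal.mem_colonElem] using this

theorem Ideal.colen_add_one_le_of_lt {I J : Ideal R} (h : I < J) : J.colen + 1 ≤ I.colen := by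
  obtain ⟨h1, f, hf, hf'⟩ := SetLike.lt_iff_le_and_exists.1 h
  refine le_trans ?_ (Ideal.colen_sup_span_add_one_le hf')
  gcongr
  refine Ideal.colen_anti (sup_le h1 ?_)
  rwa [Ideal.span_singleton_le_iff_mem]

theorem Ideal.colen_maximalIdeal [IsLocalRing R] : (maximalIdeal R).colen = 1 := by
  unfold Ideal.colen
  rw [Module.length_eq_one_iff, isSimpleModule_iff_isCoatom]
  exact (maximalIdeal.isMaximal R).out

theorem Ideal.colen_eq_sup_span_add_one [IsLocalRing R] {I : Ideal R} {f : R} (hf : f ∉ I)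
    (h : ∀ y ∈ maximalIdeal R, y * f ∈ I) : I.colen = (I ⊔ Ideal.span {f}).colen + 1 := by
  refine le_antisymm ?_ (Ideal.colen_sup_span_add_one_le hf)
  have := Ideal.colen_le_sup_span_add h
  rwa [Ideal.colen_maximalIdeal] at this

/-- Upper bound for colength by a weighted chain of generators. -/
theorem Ideal.colen_le_of_chain {ι : Type*} [DecidableEq ι] (P : Finset ι) (w : ι → ℝ) (g : ι → R)
    (M J : Ideal R)
    (h : ∀ p ∈ P, ∀ y ∈ J, y * g p ∈ M ⊔ Ideal.span (g '' {q | q ∈ P ∧ w p < w q})) :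
    M.colen ≤ (M ⊔ Ideal.span (g '' (P : Set ι))).colen + P.card * J.colen := by
  induction P using Finset.induction_on_min_value w with
  | empty => simp
  | insert a s ha hmin ih =>
    have h1 := ih fun p hp y hy => by
      refine SetLike.le_def.1 (sup_le_sup le_rfl (Ideal.span_mono (Set.image_mono ?_)))
        (h p (Finset.mem_insert_of_mem hp) y hy)
      rintro q ⟨hq, hw⟩
      refine ⟨(Finset.mem_insert.1 hq).resolve_left ?_, hw⟩
      rintro rfl
      exact (hmin p hp).not_gt hw
    refine h1.trans ?_
    have h2 : ∀ y ∈ J, y * g a ∈ M ⊔ Ideal.span (g '' (s : Set ι)) := fun y hy => by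
      refine SetLike.le_def.1 (sup_le_sup le_rfl (Ideal.span_mono (Set.image_mono ?_)))
        (h a (Finset.mem_insert_self a s) y hy)
      rintro q ⟨hq, hw⟩
      refine (Finset.mem_insert.1 hq).resolve_left ?_
      rintro rfl
      exact hw.false
    have h3 := Ideal.colen_le_sup_span_add h2
    have h4 : M ⊔ Ideal.span (g '' (s : Set ι)) ⊔ Ideal.span {g a}
        = M ⊔ Ideal.span (g '' ((insert a s : Finset ι) : Set ι)) := by
      rw [sup_assoc, ← Ideal.span_union, Finset.coe_insert, Set.image_insert_eq,
        Set.union_singleton]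
    rw [h4] at h3
    rw [Finset.card_insert_of_notMem ha]
    rw [Nat.cast_add, Nat.cast_one, add_mul, one_mul, add_comm _ J.colen, ← add_assoc]
    exact add_le_add_left h3 _

/-- Lower bound for colength by a chain of ideals. -/
theorem Ideal.le_colen_of_chain {ι : Type*} [DecidableEq ι] (P : Finset ι) (w : ι → ℝ)
    (E E' : ι → Ideal R) (K : ℕ) (I : Ideal R) (hw : Set.InjOn w P)
    (hE : ∀ p ∈ P, (E p).colen + K ≤ (E' p).colen) (hI : ∀ p ∈ P, I ≤ E' p)
    (hlt : ∀ p ∈ P, ∀ q ∈ P, w p < w q → E q ≤ E' p) : (K * P.card : ℕ) ≤ I.colen := by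
  induction P using Finset.induction_on_max_value w generalizing I with
  | empty => simp
  | insert a s ha hmax ih =>
    have h1 := ih (E a) (hw.mono (by simp)) (fun p hp => hE p (Finset.mem_insert_of_mem hp))
      (fun p hp => hlt p (Finset.mem_insert_of_mem hp) a (Finset.mem_insert_self _ _) (by
        refine lt_of_le_of_ne (hmax p hp) fun h => ha ?_
        have := hw (by simp [hp]) (by simp) h
        rwa [← this]))
      (fun p hp q hq => hlt p (Finset.mem_insert_of_mem hp) q (Finset.mem_insert_of_mem hq))
    rw [Finset.card_insert_of_notMem ha]
    calc ((K * (s.card + 1) : ℕ) : ℕ∞) = (K * s.card : ℕ) + K := by push_cast; ring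
      _ ≤ (E a).colen + K := by gcongr
      _ ≤ (E' a).colen := hE a (Finset.mem_insert_self _ _)
      _ ≤ I.colen := Ideal.colen_anti (hI a (Finset.mem_insert_self _ _))

theorem Ideal.colen_add_le_of_independent [IsLocalRing R] {I I' : Ideal R} (hI : I' ≤ I) {K : ℕ}
    (g : Fin K → R) (hg : ∀ i, g i ∈ I)
    (hind : ∀ c : Fin K → R, (∃ i, c i ∉ maximalIdeal R) → ∑ i, c i * g i ∉ I') :
    I.colen + K ≤ I'.colen := by
  induction K generalizing I with
  | zero => simpa using Ideal.colen_anti hI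
  | succ K ih =>
    have hle : I' ⊔ Ideal.span (Set.range fun i : Fin K => g i.castSucc) ≤ I := by
      refine sup_le hI (Ideal.span_le.2 ?_)
      rintro _ ⟨i, rfl⟩
      exact hg _
    have h1 := ih (I := I' ⊔ Ideal.span (Set.range fun i : Fin K => g i.castSucc)) le_sup_left
      (fun i => g i.castSucc) (fun i => Ideal.mem_sup_right (Ideal.subset_span ⟨i, rfl⟩))
      (fun c ⟨i, hi⟩ => by
        have := hind (Fin.snoc (α := fun _ => R) c 0) ⟨i.castSucc, by simpa using hi⟩
        simpa [Fin.sum_univ_castSucc] using this)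
    refine le_trans ?_ h1
    push_cast
    rw [add_comm (K : ℕ∞) 1, ← add_assoc]
    gcongr
    refine Ideal.colen_add_one_le_of_lt (lt_of_le_of_ne hle fun heq => ?_)
    have h2 := hg (Fin.last K)
    rw [← heq] at h2
    obtain ⟨a, ha, b, hb, hab⟩ := Submodule.mem_sup.1 h2
    obtain ⟨c, rfl⟩ := (Ideal.mem_span_range_iff_exists_fun).1 hb
    refine hind (Fin.snoc (α := fun _ => R) (fun i => - c i) 1) ⟨Fin.last K, ?_⟩ ?_
    · simp
    · simp only [Fin.sum_univ_castSucc, Fin.snoc_castSucc, Fin.snoc_last, one_mul, neg_mul,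
        Finset.sum_neg_distrib]
      rw [← hab]
      simpa using ha

end Colength

section Growth

variable {R : Type*} [CommRing R]

/-- The monomial `∏ i, y i ^ a i`. -/
def mono {e : ℕ} (y : Fin e → R) (a : Fin e → ℕ) : R := ∏ i, y i ^ a i

theorem mono_zero {e : ℕ} (y : Fin e → R) : mono y 0 = 1 := by simp [mono]

theorem mono_add {e : ℕ} (y : Fin e → R) (a b : Fin e → ℕ) :
    mono y (a + b) = mono y a * mono y b := by
  simp [mono, pow_add, Finset.prod_mul_distrib]

theorem mono_single {e : ℕ} (y : Fin e → R) (i : Fin e) (n : ℕ) :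
    mono y (Pi.single i n) = y i ^ n := by
  unfold mono
  rw [Finset.prod_eq_single i]
  · simp
  · intro j _ hj; simp [hj]
  · simp

theorem mono_add_single {e : ℕ} (y : Fin e → R) (a : Fin e → ℕ) (i : Fin e) :
    mono y (a + Pi.single i 1) = y i * mono y a := by
  rw [mono_add, mono_single, pow_one, mul_comm]

theorem mono_ne_zero [IsDomain R] {e : ℕ} {y : Fin e → R} (hy : ∀ i, y i ≠ 0) (a : Fin e → ℕ) :
    mono y a ≠ 0 := Finset.prod_ne_zero_iff.2 fun i _ => pow_ne_zero _ (hy i)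

theorem mono_mem_pow {e : ℕ} (y : Fin e → R) (a : Fin e → ℕ) (I : Ideal R) (hy : ∀ i, y i ∈ I) :
    mono y a ∈ I ^ (∑ i, a i) := by
  rw [← Finset.prod_pow_eq_pow_sum]
  exact Ideal.prod_mem_prod fun i _ => Ideal.pow_mem_pow (hy i) _

theorem mul_mono_mem_of_forall {e : ℕ} (y : Fin e → R) (a : Fin e → ℕ) (I M : Ideal R)
    (hM : M ≤ I) (h : ∀ i, mono y (a + Pi.single i 1) ∈ I) :
    ∀ z ∈ M ⊔ Ideal.span (Set.range y), z * mono y a ∈ I := by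
  intro z hz
  have : M ⊔ Ideal.span (Set.range y) ≤ I.colonElem (mono y a) := by
    refine sup_le (fun x hx => Ideal.mem_colonElem.2 (I.mul_mem_right _ (hM hx)))
      (Ideal.span_le.2 ?_)
    rintro _ ⟨i, rfl⟩
    refine Ideal.mem_colonElem.2 ?_
    rw [← mono_add_single]
    exact h i
  exact Ideal.mem_colonElem.1 (this hz)

theorem Ideal.colen_sup_span_pow_le {e : ℕ} (M : Ideal R) (y : Fin e → R) (n : ℕ) :
    (M ⊔ Ideal.span (Set.range y) ^ n).colen
      ≤ (n ^ e : ℕ) * (M ⊔ Ideal.span (Set.range y)).colen := by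
  classical
  set J := Ideal.span (Set.range y) with hJ
  rcases Nat.eq_zero_or_pos n with rfl | hn
  · simp [Ideal.colen_top]
  set P : Finset (Fin e → ℕ) :=
    (Fintype.piFinset fun _ => Finset.range n).filter fun a => ∑ i, a i < n
  have hyJ : ∀ i, y i ∈ J := fun i => Ideal.subset_span ⟨i, rfl⟩
  have hP : ∀ a : Fin e → ℕ, ∑ i, a i < n → a ∈ P := fun a ha => by
    refine Finset.mem_filter.2 ⟨Fintype.mem_piFinset.2 fun i => Finset.mem_range.2 ?_, ha⟩
    exact lt_of_le_of_lt (Finset.single_le_sum (fun _ _ => Nat.zero_le _) (Finset.mem_univ i)) ha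
  have h1 := Ideal.colen_le_of_chain P (fun a => ((∑ i, a i : ℕ) : ℝ)) (mono y) (M ⊔ J ^ n)
    (M ⊔ J) (fun a ha => by
      refine mul_mono_mem_of_forall y a _ M (le_sup_of_le_left le_sup_left) fun i => ?_
      have hs : ∑ j, (a + Pi.single i 1 : Fin e → ℕ) j = ∑ j, a j + 1 := by
        simp [Finset.sum_add_distrib]
      by_cases hlt : ∑ j, a j + 1 < n
      · refine Ideal.mem_sup_right (Ideal.subset_span ⟨_, ⟨hP _ (hs ▸ hlt), ?_⟩, rfl⟩)
        rw [hs]; push_cast; linarith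
      · refine Ideal.mem_sup_left (Ideal.mem_sup_right ?_)
        exact Ideal.pow_le_pow_right (by omega) (mono_mem_pow y _ J hyJ))
  have h2 : M ⊔ J ^ n ⊔ Ideal.span (mono y '' (P : Set (Fin e → ℕ))) = ⊤ := by
    rw [Ideal.eq_top_iff_one]
    refine Ideal.mem_sup_right (Ideal.subset_span ⟨0, hP _ ?_, mono_zero y⟩)
    simpa using hn
  rw [h2, Ideal.colen_top, zero_add] at h1
  refine h1.trans ?_
  gcongr
  refine (Finset.card_filter_le _ _).trans ?_
  simp

variable [IsLocalRing R] [IsNoetherianRing R]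

theorem Ideal.colen_maximalIdeal_pow_ne_top (k : ℕ) : (maximalIdeal R ^ k).colen ≠ ⊤ := by
  classical
  induction k with
  | zero => simp [Ideal.colen_top]
  | succ k ih =>
    obtain ⟨s, hs⟩ := IsNoetherian.noetherian (maximalIdeal R ^ k)
    have h1 := Ideal.colen_le_of_chain s (fun _ => 0) id (maximalIdeal R ^ (k + 1))
      (maximalIdeal R) (fun p hp y hy => Ideal.mem_sup_left (by
        rw [pow_succ']
        refine Ideal.mul_mem_mul hy ?_
        rw [← hs]
        exact Ideal.subset_span hp))
    refine ne_top_of_le_ne_top ?_ h1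
    rw [Ideal.colen_maximalIdeal, mul_one]
    refine WithTop.add_ne_top.2 ⟨ne_top_of_le_ne_top ih (Ideal.colen_anti ?_),
      ENat.natCast_ne_top _⟩
    rw [← hs]
    simp [Ideal.submodule_span_eq]

theorem Ideal.colen_ne_top_of_pow_le {I : Ideal R} {k : ℕ} (h : maximalIdeal R ^ k ≤ I) :
    I.colen ≠ ⊤ :=
  ne_top_of_le_ne_top (Ideal.colen_maximalIdeal_pow_ne_top k) (Ideal.colen_anti h)

theorem exists_system_of_parameters (R : Type*) [CommRing R] [IsLocalRing R] [IsNoetherianRing R]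
    {d : ℕ} (hd : ringKrullDim R = d) :
    ∃ y : Fin d → R, (∀ i, y i ∈ maximalIdeal R) ∧
      ∃ s : ℕ, maximalIdeal R ^ s ≤ Ideal.span (Set.range y) := by
  obtain ⟨S, hS, hcard⟩ :=
    Ideal.exists_finset_card_eq_height_of_isNoetherianRing (maximalIdeal R)
  have hc : S.card = d := by
    rw [← IsLocalRing.maximalIdeal_height_eq_ringKrullDim, ← hcard] at hd
    exact_mod_cast hd
  subst hc
  have hr : Set.range (fun i => (S.equivFin.symm i : R)) = S := by
    ext r
    simp only [Set.mem_range, SetLike.mem_coe]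
    constructor
    · rintro ⟨i, rfl⟩; exact (S.equivFin.symm i).2
    · intro h; exact ⟨S.equivFin ⟨r, h⟩, by simp⟩
  refine ⟨fun i => (S.equivFin.symm i : R),
    fun i => hS.le (Ideal.subset_span (S.equivFin.symm i).2), ?_⟩
  rw [hr]
  have := IsLocalRing.quotient_artinian_of_mem_minimalPrimes_of_isLocalRing _ hS
  exact IsLocalRing.exists_maximalIdeal_pow_le_of_isArtinianRing_quotient (Ideal.span (S : Set R))

theorem exists_colen_span_sup_le [IsDomain R] {d : ℕ} (hd : ringKrullDim R = d) {f : R}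
    (hf : f ≠ 0) :
    ∃ c : ℕ, ∀ n : ℕ, (Ideal.span {f} ⊔ maximalIdeal R ^ n).colen ≤ (c * n ^ (d - 1) : ℕ) := by
  by_cases hu : f ∈ maximalIdeal R
  swap
  · refine ⟨0, fun n => ?_⟩
    have : IsUnit f := by simpa using hu
    rw [Ideal.span_singleton_eq_top.2 this]
    simp [Ideal.colen_top]
  have hne : Ideal.span {f} ≠ ⊤ := by
    rw [Ne, Ideal.span_singleton_eq_top]; simpa using hu
  have : Nontrivial (R ⧸ Ideal.span {f}) := Ideal.Quotient.nontrivial_iff.2 hne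
  have hsurj := Ideal.Quotient.mk_surjective (I := Ideal.span {f})
  have : IsLocalRing (R ⧸ Ideal.span {f}) := IsLocalRing.of_surjective' _ hsurj
  have hdim := ringKrullDim_quotient_succ_le_of_nonZeroDivisor (mem_nonZeroDivisors_of_ne_zero hf)
  obtain ⟨e, he⟩ : ∃ e : ℕ, ringKrullDim (R ⧸ Ideal.span {f}) = e := by
    have h1 : ringKrullDim (R ⧸ Ideal.span {f}) ≠ ⊥ := ringKrullDim_ne_bot
    have h2 : ringKrullDim (R ⧸ Ideal.span {f}) ≠ ⊤ := ringKrullDim_ne_top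
    generalize ringKrullDim (R ⧸ Ideal.span {f}) = x at h1 h2
    cases x with
    | bot => exact absurd rfl h1
    | coe x =>
      cases x with
      | top => exact absurd rfl h2
      | coe x => exact ⟨x, rfl⟩
  rw [he, hd] at hdim
  have hed : e + 1 ≤ d := by exact_mod_cast hdim
  obtain ⟨y, hy, s, hs⟩ := exists_system_of_parameters _ he
  choose z hz using fun i => hsurj (y i)
  have hzm : ∀ i, z i ∈ maximalIdeal R := fun i => by
    rw [mem_maximalIdeal, mem_nonunits_iff]
    intro hu
    have := hu.map (Ideal.Quotient.mk (Ideal.span {f}))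
    rw [hz] at this
    exact (mem_nonunits_iff.1 ((mem_maximalIdeal _).1 (hy i))) this
  have hle : maximalIdeal R ^ s ≤ Ideal.span {f} ⊔ Ideal.span (Set.range z) := by
    have h1 : (maximalIdeal R).map (Ideal.Quotient.mk (Ideal.span {f}))
        ≤ maximalIdeal (R ⧸ Ideal.span {f}) := by
      refine Ideal.map_le_iff_le_comap.2 ?_
      have : (Ideal.comap (Ideal.Quotient.mk (Ideal.span {f}))
        (maximalIdeal (R ⧸ Ideal.span {f}))) ≠ ⊤ := Ideal.IsPrime.ne_top inferInstance
      have hmax := Ideal.comap_isMaximal_of_surjective (Ideal.Quotient.mk (Ideal.span {f})) hsurj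
        (K := maximalIdeal (R ⧸ Ideal.span {f}))
      exact (IsLocalRing.eq_maximalIdeal hmax).ge
    have h2 : (maximalIdeal R ^ s).map (Ideal.Quotient.mk (Ideal.span {f}))
        ≤ (Ideal.span (Set.range z)).map (Ideal.Quotient.mk (Ideal.span {f})) := by
      rw [Ideal.map_pow, Ideal.map_span, ← Set.range_comp]
      refine (Ideal.pow_right_mono h1 s).trans (hs.trans (le_of_eq ?_))
      congr 2
      ext i; exact (hz i).symm
    have h3 := Ideal.map_le_iff_le_comap.1 h2
    rw [Ideal.comap_map_of_surjective _ hsurj, ← RingHom.ker_eq_comap_bot, Ideal.mk_ker,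
      sup_comm] at h3
    exact h3
  obtain ⟨c, hc⟩ := ENat.ne_top_iff_exists.1 (Ideal.colen_ne_top_of_pow_le hle)
  refine ⟨c, fun n => ?_⟩
  rcases Nat.eq_zero_or_pos n with rfl | hn
  · simp [Ideal.colen_top]
  calc (Ideal.span {f} ⊔ maximalIdeal R ^ n).colen
      ≤ (Ideal.span {f} ⊔ Ideal.span (Set.range z) ^ n).colen := by
        refine Ideal.colen_anti (sup_le_sup le_rfl (Ideal.pow_right_mono (Ideal.span_le.2 ?_) n))
        rintro _ ⟨i, rfl⟩
        exact hzm i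
    _ ≤ (n ^ e : ℕ) * c := by rw [hc]; exact Ideal.colen_sup_span_pow_le _ _ _
    _ ≤ (c * n ^ (d - 1) : ℕ) := by
        rw [mul_comm]
        norm_cast
        gcongr
        omega

end Growth

section RealValuation

variable {R K : Type*} [CommRing R] [Field K] [Algebra R K]

variable (R K) in
/-- A real valuation of `K`, written additively, which is nonnegative on `R`.
Its value at zero is irrelevant. -/
structure RVal where
  /-- the underlying function -/
  toFun : K → ℝ
  map_mul' : ∀ x y : K, x ≠ 0 → y ≠ 0 → toFun (x * y) = toFun x + toFun y
  map_add' : ∀ x y : K, x ≠ 0 → y ≠ 0 → x + y ≠ 0 → min (toFun x) (toFun y) ≤ toFun (x + y)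
  nonneg' : ∀ r : R, algebraMap R K r ≠ 0 → 0 ≤ toFun (algebraMap R K r)

namespace RVal

instance : CoeFun (RVal R K) fun _ => K → ℝ := ⟨RVal.toFun⟩

variable (v : RVal R K)

protected theorem map_mul {x y : K} (hx : x ≠ 0) (hy : y ≠ 0) : v (x * y) = v x + v y :=
  v.map_mul' x y hx hy

protected theorem map_one : v 1 = 0 := by
  have := v.map_mul one_ne_zero one_ne_zero
  rw [mul_one] at this
  linarith

protected theorem map_inv {x : K} (hx : x ≠ 0) : v x⁻¹ = - v x := by
  have := v.map_mul hx (inv_ne_zero hx)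
  rw [mul_inv_cancel₀ hx, v.map_one] at this
  linarith

protected theorem map_div {x y : K} (hx : x ≠ 0) (hy : y ≠ 0) : v (x / y) = v x - v y := by
  rw [div_eq_mul_inv, v.map_mul hx (inv_ne_zero hy), v.map_inv hy, sub_eq_add_neg]

protected theorem map_pow {x : K} (hx : x ≠ 0) (n : ℕ) : v (x ^ n) = n * v x := by
  induction n with
  | zero => simp [v.map_one]
  | succ n ih =>
    rw [pow_succ, v.map_mul (pow_ne_zero _ hx) hx, ih]
    push_cast; ring

protected theorem map_zpow {x : K} (hx : x ≠ 0) (n : ℤ) : v (x ^ n) = n * v x := by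
  cases n with
  | ofNat n => simp [v.map_pow hx]
  | negSucc n =>
    rw [zpow_negSucc, v.map_inv (pow_ne_zero _ hx), v.map_pow hx]
    push_cast; ring

protected theorem map_neg_one : v (-1) = 0 := by
  have h : (-1 : K) ≠ 0 := by simp
  have := v.map_mul h h
  rw [neg_mul_neg, mul_one, v.map_one] at this
  linarith

protected theorem map_neg {x : K} (hx : x ≠ 0) : v (-x) = v x := by
  rw [← neg_one_mul, v.map_mul (by simp) hx, v.map_neg_one, zero_add]

protected theorem map_prod {ι : Type*} (s : Finset ι) (f : ι → K) (h : ∀ i ∈ s, f i ≠ 0) :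
    v (∏ i ∈ s, f i) = ∑ i ∈ s, v (f i) := by
  classical
  induction s using Finset.induction_on with
  | empty => simp [v.map_one]
  | insert a s ha ih =>
    rw [Finset.prod_insert ha, Finset.sum_insert ha,
      v.map_mul (h a (by simp)) (Finset.prod_ne_zero_iff.2 fun i hi => h i (by simp [hi])),
      ih fun i hi => h i (by simp [hi])]

/-- `v x ≥ t`, where zero has value infinity. -/
def GE (t : ℝ) (x : K) : Prop := x ≠ 0 → t ≤ v x

/-- `v x > t`, where zero has value infinity. -/
def GT (t : ℝ) (x : K) : Prop := x ≠ 0 → t < v x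

variable {v}

theorem GT.ge {t : ℝ} {x : K} (h : v.GT t x) : v.GE t x := fun hx => (h hx).le

theorem GE.add {t : ℝ} {x y : K} (hx : v.GE t x) (hy : v.GE t y) : v.GE t (x + y) := by
  intro h
  by_cases h1 : x = 0
  · subst h1; rw [zero_add] at h ⊢; exact hy h
  by_cases h2 : y = 0
  · subst h2; rw [add_zero] at h ⊢; exact hx h
  exact (le_min (hx h1) (hy h2)).trans (v.map_add' x y h1 h2 h)

theorem GT.add {t : ℝ} {x y : K} (hx : v.GT t x) (hy : v.GT t y) : v.GT t (x + y) := by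
  intro h
  by_cases h1 : x = 0
  · subst h1; rw [zero_add] at h ⊢; exact hy h
  by_cases h2 : y = 0
  · subst h2; rw [add_zero] at h ⊢; exact hx h
  exact (lt_min (hx h1) (hy h2)).trans_le (v.map_add' x y h1 h2 h)

theorem GE.mul {s t : ℝ} {x y : K} (hx : v.GE s x) (hy : v.GE t y) : v.GE (s + t) (x * y) := by
  intro h
  have h1 := left_ne_zero_of_mul h
  have h2 := right_ne_zero_of_mul h
  rw [v.map_mul h1 h2]
  exact add_le_add (hx h1) (hy h2)

theorem GE.mul_gt {s t : ℝ} {x y : K} (hx : v.GE s x) (hy : v.GT t y) :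
    v.GT (s + t) (x * y) := by
  intro h
  have h1 := left_ne_zero_of_mul h
  have h2 := right_ne_zero_of_mul h
  rw [v.map_mul h1 h2]
  exact add_lt_add_of_le_of_lt (hx h1) (hy h2)

theorem GE.mono {s t : ℝ} {x : K} (h : s ≤ t) (hx : v.GE t x) : v.GE s x :=
  fun hx0 => h.trans (hx hx0)

theorem GE.gt {s t : ℝ} {x : K} (h : s < t) (hx : v.GE t x) : v.GT s x :=
  fun hx0 => h.trans_le (hx hx0)

theorem GT.neg {t : ℝ} {x : K} (hx : v.GT t x) : v.GT t (-x) := by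
  intro h
  have h1 : x ≠ 0 := neg_ne_zero.1 h
  rw [v.map_neg h1]; exact hx h1

theorem GT.sum {ι : Type*} {s : Finset ι} {f : ι → K} {t : ℝ} (h : ∀ i ∈ s, v.GT t (f i)) :
    v.GT t (∑ i ∈ s, f i) :=
  Finset.sum_induction f (v.GT t) (fun _ _ => GT.add) (fun h => absurd rfl h) h

variable (v)

theorem ge_self (x : K) : v.GE (v x) x := fun _ => le_rfl

theorem ge_algebraMap (r : R) : v.GE 0 (algebraMap R K r) := fun h => v.nonneg' r h

protected theorem map_add_eq_of_gt {x y : K} (hx : x ≠ 0) (hy : v.GT (v x) y) :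
    x + y ≠ 0 ∧ v (x + y) = v x := by
  have hne : x + y ≠ 0 := by
    intro h
    have h1 : y = -x := (neg_eq_of_add_eq_zero_right h).symm
    have h2 := hy (by rw [h1]; simpa using hx)
    rw [h1, v.map_neg hx] at h2
    exact h2.false
  refine ⟨hne, le_antisymm ?_ ((v.ge_self x).add hy.ge hne)⟩
  by_contra! hlt
  have h1 : v.GT (v x) (x + y) := fun _ => hlt
  have h2 := h1.add hy.neg
  rw [add_neg_cancel_right] at h2
  exact (h2 hx).false

/-- The ideal of elements of `R` with value at least `t`. -/
def ideal (t : ℝ) : Ideal R where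
  carrier := {r | v.GE t (algebraMap R K r)}
  add_mem' {a b} ha hb := by
    rw [Set.mem_ofPred_eq, map_add]; exact GE.add ha hb
  zero_mem' h := absurd (map_zero _) h
  smul_mem' c x hx := by
    rw [Set.mem_ofPred_eq, smul_eq_mul, map_mul]
    have := (v.ge_algebraMap c).mul hx
    rwa [zero_add] at this

/-- The ideal of elements of `R` with value greater than `t`. -/
def ideal' (t : ℝ) : Ideal R where
  carrier := {r | v.GT t (algebraMap R K r)}
  add_mem' {a b} ha hb := by
    rw [Set.mem_ofPred_eq, map_add]; exact GT.add ha hb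
  zero_mem' h := absurd (map_zero _) h
  smul_mem' c x hx := by
    rw [Set.mem_ofPred_eq, smul_eq_mul, map_mul]
    have := (v.ge_algebraMap c).mul_gt hx
    rwa [zero_add] at this

theorem mem_ideal {t : ℝ} {r : R} : r ∈ v.ideal t ↔ v.GE t (algebraMap R K r) := Iff.rfl

theorem mem_ideal' {t : ℝ} {r : R} : r ∈ v.ideal' t ↔ v.GT t (algebraMap R K r) := Iff.rfl

theorem ideal'_le_ideal (t : ℝ) : v.ideal' t ≤ v.ideal t := fun _ h => GT.ge h

theorem ideal_le_ideal' {s t : ℝ} (h : s < t) : v.ideal t ≤ v.ideal' s := fun _ hr => GE.gt h hr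

theorem ideal_le_ideal {s t : ℝ} (h : s ≤ t) : v.ideal t ≤ v.ideal s := fun _ hr => GE.mono h hr

theorem ideal_zero : v.ideal 0 = ⊤ := (Ideal.eq_top_iff_one _).2 (v.ge_algebraMap 1)

theorem pow_le_ideal {I : Ideal R} {t : ℝ} (h : I ≤ v.ideal t) (n : ℕ) :
    I ^ n ≤ v.ideal (n * t) := by
  induction n with
  | zero => simp [v.ideal_zero]
  | succ n ih =>
    rw [pow_succ, Ideal.mul_le]
    intro a ha b hb
    rw [mem_ideal, map_mul]
    refine GE.mono (le_of_eq ?_) (GE.mul (ih ha) (h hb))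
    push_cast; ring

/-- The values of `v` on the nonzero elements of an ideal. -/
def values (I : Ideal R) : Set ℝ := {t | ∃ f ∈ I, f ≠ 0 ∧ v (algebraMap R K f) = t}

theorem values_mono {I J : Ideal R} (h : I ≤ J) : v.values I ⊆ v.values J := by
  rintro t ⟨f, hf, h1⟩
  exact ⟨f, h hf, h1⟩

/-- Two elements of the same value are proportional up to higher value. -/
def Leaf : Prop :=
  ∀ f g : R, f ≠ 0 → g ≠ 0 → v (algebraMap R K f) = v (algebraMap R K g) →
    ∃ c : R, f - c * g ∈ v.ideal' (v (algebraMap R K f))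

variable [IsFractionRing R K]

theorem finite_values {t : ℝ} (ht : (v.ideal t).colen ≠ ⊤) :
    (v.values (⊤ : Ideal R) ∩ Set.Iio t).Finite := by
  classical
  obtain ⟨c, hc⟩ := ENat.ne_top_iff_exists.1 ht
  by_contra hinf
  obtain ⟨P, hP, hcard⟩ := Set.Infinite.exists_subset_card_eq hinf (c + 1)
  have h := Ideal.le_colen_of_chain P id (fun p => v.ideal p) (fun p => v.ideal' p) 1 (v.ideal t)
    (Set.injOn_id _) (fun p hp => by
      obtain ⟨⟨f, -, hf, hfp⟩, -⟩ := hP hp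
      have hf' : algebraMap R K f ≠ 0 := by simpa using hf
      refine Ideal.colen_add_one_le_of_lt (lt_of_le_of_ne (v.ideal'_le_ideal p) fun heq => ?_)
      have h1 : f ∈ v.ideal p := fun _ => hfp.ge
      rw [← heq] at h1
      exact (h1 hf').ne' hfp)
    (fun p hp => v.ideal_le_ideal' (hP hp).2)
    (fun p _ q _ hpq => v.ideal_le_ideal' hpq)
  rw [← hc, hcard, one_mul] at h
  have : c + 1 ≤ c := by exact_mod_cast h
  omega

theorem colen_eq_encard [IsDomain R] [IsLocalRing R] (hleaf : v.Leaf)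
    (hpos : ∀ y ∈ maximalIdeal R, y ≠ 0 → 0 < v (algebraMap R K y)) {t : ℝ}
    (ht : (v.ideal t).colen ≠ ⊤) {I : Ideal R} (hI : v.ideal t ≤ I) :
    I.colen = (v.values ⊤ \ v.values I).encard := by
  have hne : ∀ {r : R}, r ≠ 0 → algebraMap R K r ≠ 0 := fun h => by simpa using h
  have hlt : ∀ {I : Ideal R}, v.ideal t ≤ I → ∀ f ∉ I, v (algebraMap R K f) < t :=
    fun hI f hf => by
      by_contra! h
      exact hf (hI fun _ => h)
  have key : ∀ I : Ideal R, v.ideal t ≤ I →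
      v.values ⊤ \ v.values I ⊆ v.values (⊤ : Ideal R) ∩ Set.Iio t := by
    rintro I hI s ⟨⟨f, hf, hf0, rfl⟩, hs⟩
    refine ⟨⟨f, hf, hf0, rfl⟩, hlt hI f fun hfI => hs ⟨f, hfI, hf0, rfl⟩⟩
  have hfin := v.finite_values ht
  obtain ⟨N, hN⟩ : ∃ N, (v.values ⊤ \ v.values I).ncard = N := ⟨_, rfl⟩
  induction N using Nat.strong_induction_on generalizing I with
  | _ N ih =>
  by_cases htop : I = ⊤
  · subst htop; simp [Ideal.colen_top]
  have hset : ((fun f : R => v (algebraMap R K f)) '' {f | f ∉ I}).Finite := by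
    refine hfin.subset ?_
    rintro _ ⟨f, hf, rfl⟩
    exact ⟨⟨f, trivial, fun h => hf (h ▸ I.zero_mem), rfl⟩, hlt hI f hf⟩
  obtain ⟨f, hf, hmax⟩ : ∃ f ∉ I, ∀ g ∉ I, v (algebraMap R K g) ≤ v (algebraMap R K f) := by
    obtain ⟨f0, hf0⟩ : ∃ f, f ∉ I := by
      by_contra! h
      exact htop (Ideal.eq_top_iff_one _ |>.2 (h 1))
    obtain ⟨_, ⟨f, hf, rfl⟩, hm⟩ := hset.exists_maximal ⟨_, ⟨f0, hf0, rfl⟩⟩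
    refine ⟨f, hf, fun g hg => ?_⟩
    by_contra! hlt
    exact hlt.not_ge (hm ⟨g, hg, rfl⟩ hlt.le)
  have hgtI : ∀ g, v.GT (v (algebraMap R K f)) (algebraMap R K g) → g ∈ I := fun g hg => by
    by_contra hgI
    exact (hg (hne fun h => hgI (h ▸ I.zero_mem))).not_ge (hmax g hgI)
  have hf0 : f ≠ 0 := fun h => hf (h ▸ I.zero_mem)
  have hfv : v (algebraMap R K f) ∉ v.values I := by
    rintro ⟨g, hg, hg0, hgf⟩
    obtain ⟨c, hc⟩ := hleaf f g hf0 hg0 hgf.symm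
    have := I.add_mem (hgtI _ hc) (I.mul_mem_left c hg)
    rw [sub_add_cancel] at this
    exact hf this
  have hmf : ∀ y ∈ maximalIdeal R, y * f ∈ I := fun y hy => by
    refine hgtI _ fun h => ?_
    have hy0 : y ≠ 0 := by rintro rfl; simp at h
    rw [map_mul, v.map_mul (hne hy0) (hne hf0)]
    linarith [hpos y hy hy0]
  have hval : v.values (I ⊔ Ideal.span {f}) = insert (v (algebraMap R K f)) (v.values I) := by
    ext s
    constructor
    · rintro ⟨h, hh, hh0, rfl⟩
      obtain ⟨a, ha, b, hb, rfl⟩ := Submodule.mem_sup.1 hh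
      obtain ⟨c, rfl⟩ := Ideal.mem_span_singleton'.1 hb
      by_cases hc : c ∈ maximalIdeal R
      · exact Or.inr ⟨_, I.add_mem ha (hmf c hc), hh0, rfl⟩
      have hcu : IsUnit c := by simpa using hc
      have hc0 : c ≠ 0 := hcu.ne_zero
      have hvc : v (algebraMap R K c) = 0 := by
        obtain ⟨c', hc'⟩ := hcu.exists_right_inv
        have hc'0 : c' ≠ 0 := by rintro rfl; simp at hc'
        have h1 := v.map_mul (hne hc0) (hne hc'0)
        rw [← map_mul, hc', map_one, v.map_one] at h1
        have h2 := v.nonneg' c (hne hc0)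
        have h3 := v.nonneg' c' (hne hc'0)
        linarith
      have hvcf : v (algebraMap R K (c * f)) = v (algebraMap R K f) := by
        rw [map_mul, v.map_mul (hne hc0) (hne hf0), hvc, zero_add]
      by_cases ha0 : a = 0
      · subst ha0
        rw [zero_add, hvcf]; exact Or.inl rfl
      rcases lt_trichotomy (v (algebraMap R K a)) (v (algebraMap R K f)) with h | h | h
      · right
        have := v.map_add_eq_of_gt (hne ha0) (y := algebraMap R K (c * f))
          (fun _ => by rw [hvcf]; exact h)
        refine ⟨a, ha, ha0, ?_⟩
        rw [map_add, this.2]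
      · exact absurd ⟨a, ha, ha0, h⟩ hfv
      · left
        have := v.map_add_eq_of_gt (hne (mul_ne_zero hc0 hf0)) (y := algebraMap R K a)
          (fun _ => by rw [hvcf]; exact h)
        rw [map_add, add_comm, this.2, hvcf]
    · rintro (rfl | ⟨g, hg, h1⟩)
      · exact ⟨f, Ideal.mem_sup_right (Ideal.subset_span rfl), hf0, rfl⟩
      · exact ⟨g, Ideal.mem_sup_left hg, h1⟩
  have hmem : v (algebraMap R K f) ∈ v.values ⊤ \ v.values I := ⟨⟨f, trivial, hf0, rfl⟩, hfv⟩
  have hdiff : v.values ⊤ \ v.values I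
      = insert (v (algebraMap R K f)) (v.values ⊤ \ v.values (I ⊔ Ideal.span {f})) := by
    rw [hval]
    ext s
    by_cases hs : s = v (algebraMap R K f)
    · subst hs; simpa using hmem
    · simp [hs]
  have hnot : v (algebraMap R K f) ∉ v.values ⊤ \ v.values (I ⊔ Ideal.span {f}) := by
    rw [hval]; simp
  have hI' : v.ideal t ≤ I ⊔ Ideal.span {f} := le_sup_of_le_left hI
  rw [Ideal.colen_eq_sup_span_add_one hf hmf, hdiff, Set.encard_insert_of_notMem hnot]
  rw [ih _ ?_ hI' rfl]
  rw [← hN, hdiff, Set.ncard_insert_of_notMem hnot (hfin.subset (key _ hI'))]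
  omega

end RVal

end RealValuation

section LeafCriterion

variable {R K : Type*} [CommRing R] [Field K] [Algebra R K]

namespace RVal

variable (v : RVal R K)

theorem gt_zero_aeval {x : K} (hx : v.GE 0 x) {p : Polynomial R}
    (hp : ∀ i, p.coeff i ∈ v.ideal' 0) : v.GT 0 (Polynomial.aeval x p) := by
  rw [Polynomial.aeval_eq_sum_range]
  refine GT.sum fun i hi => ?_
  clear hi
  rw [Algebra.smul_def]
  have hxi : v.GE 0 (x ^ i) := by
    induction i with
    | zero => rw [pow_zero]; exact fun _ => v.map_one.ge
    | succ i ih => rw [pow_succ]; simpa using GE.mul ih hx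
  have := GE.mul_gt hxi (hp i)
  rwa [zero_add, mul_comm] at this

protected theorem map_unit (u : Rˣ) : v (algebraMap R K u) = 0 := by
  have h1 : IsUnit (algebraMap R K u) := u.isUnit.map _
  have h2 : IsUnit (algebraMap R K ↑u⁻¹) := (u⁻¹).isUnit.map _
  have h3 := v.map_mul h1.ne_zero h2.ne_zero
  rw [← _root_.map_mul, u.mul_inv, _root_.map_one, v.map_one] at h3
  linarith [v.nonneg' _ h1.ne_zero, v.nonneg' _ h2.ne_zero]

theorem exists_sub_gt_zero [IsLocalRing R] [IsAlgClosed (ResidueField R)]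
    (hpos : maximalIdeal R ≤ v.ideal' 0) {x : K} (hx : v.GE 0 x) {p : Polynomial R}
    (hp : ∃ i, p.coeff i ∉ maximalIdeal R) (hpx : v.GT 0 (Polynomial.aeval x p)) :
    ∃ c : R, v.GT 0 (x - algebraMap R K c) := by
  set s : ResidueField R → R := Function.surjInv residue_surjective
  have hs : ∀ a, residue R (s a) = a := Function.surjInv_eq residue_surjective
  set pb := p.map (residue R)
  have hpb : pb ≠ 0 := by
    obtain ⟨i, hi⟩ := hp
    intro h
    have := congrArg (fun q => Polynomial.coeff q i) h
    simp only [pb, Polynomial.coeff_map, Polynomial.coeff_zero] at this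
    exact hi ((residue_eq_zero_iff _).1 this)
  have hsplit := (IsAlgClosed.splits pb).eq_prod_roots
  set q : Polynomial R := Polynomial.C (s pb.leadingCoeff) *
    (pb.roots.map fun a => Polynomial.X - Polynomial.C (s a)).prod with hq
  have hqb : q.map (residue R) = pb := by
    rw [hq, Polynomial.map_mul, Polynomial.map_C, hs, Polynomial.map_multiset_prod,
      Multiset.map_map]
    conv_rhs => rw [hsplit]
    simp [hs]
  have hqx : v.GT 0 (Polynomial.aeval x q) := by
    have h1 : v.GT 0 (Polynomial.aeval x (q - p)) := by
      refine v.gt_zero_aeval hx fun i => hpos ?_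
      rw [← residue_eq_zero_iff, ← Polynomial.coeff_map, Polynomial.map_sub, hqb]
      simp [pb]
    have := h1.add hpx
    rwa [map_sub, sub_add_cancel] at this
  by_contra! hcon
  have hcon' : ∀ c : R, x - algebraMap R K c ≠ 0 ∧ v (x - algebraMap R K c) ≤ 0 := by
    intro c
    have := hcon c
    unfold RVal.GT at this
    push Not at this
    exact this
  have hu : IsUnit (s pb.leadingCoeff) := by
    by_contra h
    have : s pb.leadingCoeff ∈ maximalIdeal R := h
    rw [← residue_eq_zero_iff, hs] at this
    exact hpb (Polynomial.leadingCoeff_eq_zero.1 this)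
  have hprod : ∀ M : Multiset (ResidueField R),
      (M.map fun a => x - algebraMap R K (s a)).prod ≠ 0 ∧
        v (M.map fun a => x - algebraMap R K (s a)).prod ≤ 0 := by
    intro M
    induction M using Multiset.induction_on with
    | empty => simp [v.map_one]
    | cons a M ih =>
      rw [Multiset.map_cons, Multiset.prod_cons]
      refine ⟨mul_ne_zero (hcon' _).1 ih.1, ?_⟩
      rw [v.map_mul (hcon' _).1 ih.1]
      linarith [(hcon' (s a)).2, ih.2]
  have haq : Polynomial.aeval x q = algebraMap R K (s pb.leadingCoeff) *
      (pb.roots.map fun a => x - algebraMap R K (s a)).prod := by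
    rw [hq, map_mul, Polynomial.aeval_C, map_multiset_prod, Multiset.map_map]
    simp
  obtain ⟨u, hu⟩ := hu
  have hune : algebraMap R K (s pb.leadingCoeff) ≠ 0 := by
    rw [← hu]; exact (u.isUnit.map (algebraMap R K)).ne_zero
  rw [haq] at hqx
  have h1 := hqx (mul_ne_zero hune (hprod _).1)
  rw [v.map_mul hune (hprod _).1, ← hu, v.map_unit] at h1
  linarith [(hprod pb.roots).2]

theorem leaf_of_forall [IsLocalRing R] [IsAlgClosed (ResidueField R)] [IsFractionRing R K]
    (hpos : maximalIdeal R ≤ v.ideal' 0)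
    (h : ∀ f g : R, f ≠ 0 → g ≠ 0 → v (algebraMap R K f) = v (algebraMap R K g) →
      ∃ p : Polynomial R, (∃ i, p.coeff i ∉ maximalIdeal R) ∧
        v.GT 0 (Polynomial.aeval (algebraMap R K f / algebraMap R K g) p)) : v.Leaf := by
  intro f g hf hg hfg
  have hf' : algebraMap R K f ≠ 0 := by simpa using hf
  have hg' : algebraMap R K g ≠ 0 := by simpa using hg
  obtain ⟨p, hp, hpx⟩ := h f g hf hg hfg
  obtain ⟨c, hc⟩ := v.exists_sub_gt_zero hpos (fun _ => by
    rw [v.map_div hf' hg', hfg, sub_self]) hp hpx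
  refine ⟨c, ?_⟩
  have h1 := (v.ge_self (algebraMap R K g)).mul_gt hc
  rw [mul_sub, mul_div_cancel₀ _ hg', add_zero] at h1
  rw [mem_ideal', hfg, map_sub, map_mul, mul_comm (algebraMap R K c)]
  exact h1

end RVal

end LeafCriterion

section Frames

theorem algebraMap_ne {R K : Type*} [CommRing R] [Field K] [Algebra R K] [IsFractionRing R K]
    {r : R} (h : r ≠ 0) : algebraMap R K r ≠ 0 := by simpa using h

variable {R K : Type*} [CommRing R] [IsLocalRing R] [Field K] [Algebra R K] {d : ℕ}

variable (R d) in
/-- Generators of an ideal primary to the maximal ideal with rationally independent weights. -/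
structure Frame where
  /-- the generators -/
  x : Fin d → R
  /-- the weights -/
  lam : Fin d → ℝ
  x_ne : ∀ i, x i ≠ 0
  indep : ∀ e : Fin d → ℤ, ∑ i, e i * lam i = 0 → e = 0
  /-- an exponent with `𝔪 ^ s` inside the ideal -/
  s : ℕ
  pow_le : maximalIdeal R ^ s ≤ Ideal.span (Set.range x)
  /-- a lower bound of the weights -/
  δ : ℝ
  δ_pos : 0 < δ
  δ_le : ∀ i, δ ≤ lam i

namespace Frame

variable (F : Frame R d)

theorem lam_pos (i : Fin d) : 0 < F.lam i := F.δ_pos.trans_le (F.δ_le i)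

/-- The ideal generated by the frame. -/
def J : Ideal R := Ideal.span (Set.range F.x)

/-- The weight of an exponent. -/
def wt (a : Fin d → ℕ) : ℝ := ∑ i, a i * F.lam i

/-- The sum of the weights. -/
def total : ℝ := ∑ i, F.lam i

theorem total_nonneg : 0 ≤ F.total := Finset.sum_nonneg fun i _ => (F.lam_pos i).le

theorem wt_zero : F.wt 0 = 0 := by simp [wt]

theorem wt_add (a b : Fin d → ℕ) : F.wt (a + b) = F.wt a + F.wt b := by
  simp [wt, add_mul, Finset.sum_add_distrib]

theorem wt_single (i : Fin d) (n : ℕ) : F.wt (Pi.single i n) = n * F.lam i := by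
  unfold wt
  rw [Finset.sum_eq_single i]
  · simp
  · intro j _ hj; simp [hj]
  · simp

theorem wt_inj : Function.Injective F.wt := by
  intro a b h
  have := F.indep (fun i => (a i : ℤ) - b i) (by
    unfold wt at h
    simp only [Int.cast_sub, Int.cast_natCast, sub_mul, Finset.sum_sub_distrib]
    linarith)
  funext i
  have h1 := congrFun this i
  simp only [Pi.zero_apply] at h1
  omega

theorem wt_le_of_lt {a : Fin d → ℕ} {n : ℕ} (ha : ∀ i, a i < n) : F.wt a ≤ n * F.total := by
  unfold wt total
  rw [Finset.mul_sum]
  refine Finset.sum_le_sum fun i _ => ?_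
  have := F.lam_pos i
  have h2 : (a i : ℝ) ≤ n := by exact_mod_cast (ha i).le
  gcongr

theorem mul_le_wt (a : Fin d → ℕ) (i : Fin d) : a i * F.δ ≤ F.wt a := by
  unfold wt
  refine le_trans ?_ (Finset.single_le_sum (f := fun i => (a i : ℝ) * F.lam i)
    (fun i _ => mul_nonneg (Nat.cast_nonneg _) (F.lam_pos i).le) (Finset.mem_univ i))
  have := F.δ_le i
  gcongr

/-- The values of a valuation on the frame are at least the weights. -/
def Adapted (v : RVal R K) : Prop := ∀ i, F.lam i ≤ v (algebraMap R K (F.x i))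

/-- The values of a valuation on the frame are the weights. -/
def Exact (v : RVal R K) : Prop := ∀ i, v (algebraMap R K (F.x i)) = F.lam i

variable {F}

theorem Exact.adapted {v : RVal R K} (h : F.Exact v) : F.Adapted v := fun i => (h i).ge

theorem Adapted.J_le {v : RVal R K} (h : F.Adapted v) : F.J ≤ v.ideal F.δ := by
  refine Ideal.span_le.2 ?_
  rintro _ ⟨i, rfl⟩
  exact fun _ => (F.δ_le i).trans (h i)

theorem Adapted.pow_le {v : RVal R K} (h : F.Adapted v) {n : ℕ} {t : ℝ} (ht : t ≤ n * F.δ) :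
    F.J ^ n ≤ v.ideal t :=
  (v.pow_le_ideal h.J_le n).trans (v.ideal_le_ideal ht)

theorem algebraMap_mono (a : Fin d → ℕ) :
    algebraMap R K (mono F.x a) = ∏ i, algebraMap R K (F.x i) ^ a i := by
  simp [mono, map_prod]

theorem Adapted.maximalIdeal_le {v : RVal R K} (h : F.Adapted v) :
    maximalIdeal R ≤ v.ideal' 0 := by
  intro y hy hy0
  have h1 : y ^ F.s ∈ F.J := F.pow_le (Ideal.pow_mem_pow hy _)
  have h2 := h.J_le h1
  rw [v.mem_ideal, map_pow] at h2
  have h3 := h2 (pow_ne_zero _ hy0)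
  rw [v.map_pow hy0] at h3
  have h4 := F.δ_pos.trans_le h3
  by_contra! hneg
  nlinarith [(Nat.cast_nonneg F.s : (0 : ℝ) ≤ F.s)]

section Noetherian

variable [IsNoetherianRing R]

variable (F) in
theorem colen_J_pow_le (n : ℕ) : (F.J ^ n).colen ≤ (n ^ d * F.J.colen.toNat : ℕ) := by
  have h1 := Ideal.colen_sup_span_pow_le ⊥ F.x n
  rw [bot_sup_eq, bot_sup_eq] at h1
  refine h1.trans (le_of_eq ?_)
  push_cast
  congr 1
  exact (ENat.natCast_toNat (Ideal.colen_ne_top_of_pow_le F.pow_le)).symm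

theorem Adapted.colen_ideal_ne_top {v : RVal R K} (h : F.Adapted v) (t : ℝ) :
    (v.ideal t).colen ≠ ⊤ := by
  obtain ⟨n, hn⟩ := exists_nat_ge (t / F.δ)
  rw [div_le_iff₀ F.δ_pos] at hn
  refine ne_top_of_le_ne_top ?_ (Ideal.colen_anti (h.pow_le hn))
  exact ne_top_of_le_ne_top (ENat.natCast_ne_top _) (F.colen_J_pow_le n)

end Noetherian

variable [IsFractionRing R K]

variable (F) in
theorem x_ne' (i : Fin d) : algebraMap R K (F.x i) ≠ 0 := algebraMap_ne (F.x_ne i)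

theorem Adapted.le_mono {v : RVal R K} (h : F.Adapted v) (a : Fin d → ℕ) :
    F.wt a ≤ v (algebraMap R K (mono F.x a)) := by
  rw [algebraMap_mono, v.map_prod _ _ fun i _ => pow_ne_zero _ (F.x_ne' i)]
  refine Finset.sum_le_sum fun i _ => ?_
  rw [v.map_pow (F.x_ne' i)]
  have := h i
  gcongr

theorem Exact.mono_eq {v : RVal R K} (h : F.Exact v) (a : Fin d → ℕ) :
    v (algebraMap R K (mono F.x a)) = F.wt a := by
  rw [algebraMap_mono, v.map_prod _ _ fun i _ => pow_ne_zero _ (F.x_ne' i)]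
  refine Finset.sum_congr rfl fun i _ => ?_
  rw [v.map_pow (F.x_ne' i), h i]

variable (F) in
/-- The bound for the number of elements independent modulo higher value. -/
noncomputable def bound : ℝ := F.J.colen.toNat * (F.total / F.δ + 1) ^ d

variable [IsDomain R] [IsNoetherianRing R]

theorem card_le_bound {L : Type*} [Finite L] (ν : L → RVal R K) (hν : ∀ l, F.Exact (ν l))
    (s : L → ℝ) {N : ℕ} (u : Fin N → R) (hu : ∀ i l, u i ∈ (ν l).ideal (s l))
    (hind : ∀ c : Fin N → R, (∃ i, c i ∉ maximalIdeal R) →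
      ∃ l, ∑ i, c i * u i ∉ (ν l).ideal' (s l)) : (N : ℝ) ≤ F.bound := by
  classical
  obtain ⟨t0, ht0⟩ : ∃ t0 : ℝ, ∀ l, s l ≤ t0 := by
    have := Fintype.ofFinite L
    obtain ⟨M, hM⟩ := (Set.finite_range s).bddAbove
    exact ⟨M, fun l => hM ⟨l, rfl⟩⟩
  obtain ⟨n, hn⟩ := exists_nat_ge (max 1 (t0 / F.δ + 2))
  have hn1 : (1 : ℝ) ≤ n := (le_max_left _ _).trans hn
  have hn2 : t0 / F.δ + 2 ≤ n := (le_max_right _ _).trans hn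
  obtain ⟨q, hq, hq'⟩ : ∃ q : ℕ, (n * F.total + t0) / F.δ < q ∧
      (q : ℝ) ≤ n * (F.total / F.δ + 1) := by
    by_cases hneg : (n * F.total + t0) / F.δ < 0
    · refine ⟨0, by simpa using hneg, ?_⟩
      have := div_nonneg F.total_nonneg F.δ_pos.le
      simp only [Nat.cast_zero]; positivity
    · refine ⟨⌊(n * F.total + t0) / F.δ⌋₊ + 1, by exact_mod_cast Nat.lt_floor_add_one _, ?_⟩
      have := Nat.floor_le (not_lt.1 hneg)
      push_cast
      rw [add_div, mul_div_assoc] at *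
      linarith
  rw [div_lt_iff₀ F.δ_pos] at hq
  set P : Finset (Fin d → ℕ) := Fintype.piFinset fun _ => Finset.range n
  have hcard : P.card = n ^ d := by simp [P]
  have key : ∀ a : Fin d → ℕ, ∀ (v : RVal R K) (hv : F.Exact v) (t : ℝ) (r : R),
      r * mono F.x a ∈ v.ideal' (F.wt a + t) → r ∈ v.ideal' t := by
    intro a v hv t r hr hr0
    rw [v.mem_ideal', map_mul] at hr
    have hm : algebraMap R K (mono F.x a) ≠ 0 := algebraMap_ne (mono_ne_zero F.x_ne a)
    have := hr (mul_ne_zero hr0 hm)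
    rw [v.map_mul hr0 hm, hv.mono_eq] at this
    linarith
  have h1 := Ideal.le_colen_of_chain P F.wt (fun a => ⨅ l, (ν l).ideal (F.wt a + s l))
    (fun a => ⨅ l, (ν l).ideal' (F.wt a + s l)) N (F.J ^ q) F.wt_inj.injOn
    (fun a ha => by
      refine Ideal.colen_add_le_of_independent (iInf_mono fun l => (ν l).ideal'_le_ideal _)
        (fun i => u i * mono F.x a) (fun i => ?_) (fun c hc hmem => ?_)
      · refine Submodule.mem_iInf _ |>.2 fun l => ?_
        rw [RVal.mem_ideal, map_mul, add_comm]
        exact RVal.GE.mul (hu i l) (fun _ => ((hν l).mono_eq a).ge)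
      · obtain ⟨l, hl⟩ := hind c hc
        refine hl (key a (ν l) (hν l) _ _ ?_)
        rw [Finset.sum_mul]
        simp_rw [mul_assoc]
        exact (Submodule.mem_iInf _).1 hmem l)
    (fun a ha => le_iInf fun l => by
      refine ((hν l).adapted.pow_le le_rfl).trans ((ν l).ideal_le_ideal' ?_)
      have := F.wt_le_of_lt (n := n) (a := a) fun i =>
        Finset.mem_range.1 (Fintype.mem_piFinset.1 ha i)
      linarith [ht0 l])
    (fun a _ b _ hab => iInf_mono fun l => (ν l).ideal_le_ideal' (by linarith))
  have h2 := h1.trans (F.colen_J_pow_le q)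
  rw [hcard] at h2
  have h3 : N * n ^ d ≤ q ^ d * F.J.colen.toNat := by exact_mod_cast h2
  have h4 : (N : ℝ) * n ^ d ≤ q ^ d * F.J.colen.toNat := by exact_mod_cast h3
  have h5 : (q : ℝ) ^ d ≤ (n * (F.total / F.δ + 1)) ^ d := by gcongr
  have h6 : (0 : ℝ) < n ^ d := by positivity
  have h7 : (N : ℝ) * n ^ d ≤ F.bound * n ^ d := by
    refine h4.trans ?_
    refine (mul_le_mul_of_nonneg_right h5 (Nat.cast_nonneg _)).trans (le_of_eq ?_)
    rw [mul_pow, bound]; ring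
  exact le_of_mul_le_mul_right h7 h6

theorem Exact.leaf [IsAlgClosed (ResidueField R)] {v : RVal R K} (h : F.Exact v) : v.Leaf := by
  refine v.leaf_of_forall h.adapted.maximalIdeal_le fun f g hf hg hfg => ?_
  have hf' : algebraMap R K f ≠ 0 := algebraMap_ne hf
  have hg' : algebraMap R K g ≠ 0 := algebraMap_ne hg
  obtain ⟨N, hN⟩ := exists_nat_gt F.bound
  by_contra! hcon
  refine hN.not_ge ?_
  set t := v (algebraMap R K g)
  have hval : ∀ i : Fin N, v (algebraMap R K (f ^ (i : ℕ) * g ^ (N - 1 - i))) =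
      (N - 1 : ℕ) * t := by
    intro i
    rw [map_mul, map_pow, map_pow, v.map_mul (pow_ne_zero _ hf') (pow_ne_zero _ hg'),
      v.map_pow hf', v.map_pow hg', hfg, ← add_mul]
    congr 1
    norm_cast
    omega
  refine card_le_bound (L := Unit) (fun _ => v) (fun _ => h) (fun _ => (N - 1 : ℕ) * t)
    (fun i : Fin N => f ^ (i : ℕ) * g ^ (N - 1 - i)) (fun i _ _ => (hval i).ge) ?_
  rintro c ⟨i, hi⟩
  refine ⟨(), fun hmem => ?_⟩
  set p : Polynomial R := ∑ j : Fin N, Polynomial.C (c j) * Polynomial.X ^ (j : ℕ)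
  refine hcon p ⟨i, ?_⟩ ?_
  · have : p.coeff i = c i := by
      simp only [p, Polynomial.finsetSum_coeff, Polynomial.coeff_C_mul, Polynomial.coeff_X_pow]
      rw [Finset.sum_eq_single i]
      · simp
      · intro j _ hj
        rw [if_neg fun h => hj (Fin.ext h.symm), mul_zero]
      · simp
    rwa [this]
  · have hp : Polynomial.aeval (algebraMap R K f / algebraMap R K g) p
        = algebraMap R K (∑ j, c j * (f ^ (j : ℕ) * g ^ (N - 1 - j)))
          * (algebraMap R K g ^ (N - 1))⁻¹ := by
      simp only [p, map_sum, map_mul, map_pow, Polynomial.aeval_C, Polynomial.aeval_X]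
      rw [Finset.sum_mul]
      refine Finset.sum_congr rfl fun j _ => ?_
      have : N - 1 = (j : ℕ) + (N - 1 - j) := by omega
      rw [show (algebraMap R K g ^ (N - 1))⁻¹
        = (algebraMap R K g ^ (j : ℕ))⁻¹ * (algebraMap R K g ^ (N - 1 - j))⁻¹ by
          rw [← mul_inv, ← pow_add, ← this], div_pow]
      field_simp
    rw [hp]
    have h1 := RVal.GE.mul_gt (v.ge_self (algebraMap R K g ^ (N - 1))⁻¹) hmem
    rw [v.map_inv (pow_ne_zero _ hg'), v.map_pow hg', neg_add_cancel] at h1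
    rwa [mul_comm]

end Frame

end Frames

section FiniteFamilies

variable {R K : Type*} [CommRing R] [Field K] [Algebra R K]

/-- The absolute value attached to a real valuation. -/
noncomputable def RVal.absoluteValue (v : RVal R K) : AbsoluteValue K ℝ where
  toFun x := open Classical in if x = 0 then 0 else Real.exp (-v x)
  map_mul' x y := by
    by_cases hx : x = 0
    · simp [hx]
    by_cases hy : y = 0
    · simp [hy]
    simp only [hx, hy, mul_eq_zero, or_self, if_false]
    rw [v.map_mul hx hy, neg_add, Real.exp_add]
  nonneg' x := by
    split_ifs
    · exact le_rfl
    · exact (Real.exp_pos _).le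
  eq_zero' x := by
    by_cases hx : x = 0
    · simp [hx]
    · simp [hx, Real.exp_ne_zero]
  add_le' x y := by
    by_cases hx : x = 0
    · by_cases hy : y = 0 <;> simp [hx, hy]
    by_cases hy : y = 0
    · simp [hx, hy]
    have h1 := Real.exp_pos (-v x)
    have h2 := Real.exp_pos (-v y)
    by_cases hxy : x + y = 0
    · simp only [hx, hy, hxy, if_true, if_false]; positivity
    simp only [hx, hy, hxy, if_false]
    have h3 : Real.exp (-v (x + y)) ≤ max (Real.exp (-v x)) (Real.exp (-v y)) := by
      rcases min_le_iff.1 (v.map_add' x y hx hy hxy) with h | h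
      · exact le_max_of_le_left (Real.exp_le_exp.2 (neg_le_neg h))
      · exact le_max_of_le_right (Real.exp_le_exp.2 (neg_le_neg h))
    refine h3.trans (max_le ?_ ?_) <;> linarith

theorem RVal.absoluteValue_apply (v : RVal R K) {x : K} (hx : x ≠ 0) :
    v.absoluteValue x = Real.exp (-v x) := if_neg hx

namespace Frame

variable [IsLocalRing R] [IsFractionRing R K] {d : ℕ} {F : Frame R d}

theorem not_isEquiv {v w : RVal R K} (hd : 0 < d) (hv : F.Exact v) (hw : F.Exact w) {x : K}
    (hx : x ≠ 0) (hne : v x ≠ w x) : ¬ v.absoluteValue.IsEquiv w.absoluteValue := by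
  intro h
  obtain ⟨c, hc, hcw⟩ := AbsoluteValue.isEquiv_iff_exists_rpow_eq.1 h
  have key : ∀ y : K, y ≠ 0 → v y * c = w y := by
    intro y hy
    have h1 := congrFun hcw y
    simp only [v.absoluteValue_apply hy, w.absoluteValue_apply hy, ← Real.exp_mul] at h1
    have := Real.exp_injective h1
    linarith
  have h1 := key _ (F.x_ne' ⟨0, hd⟩)
  rw [hv, hw] at h1
  have h2 := F.lam_pos ⟨0, hd⟩
  have h3 : c = 1 := by
    field_simp at h1
    exact h1
  have := key x hx
  rw [h3, mul_one] at this
  exact hne this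

theorem card_family_le [IsDomain R] [IsNoetherianRing R] (hd : 0 < d) {r : ℕ} (ν : Fin r → RVal R K)
    (hν : ∀ l, F.Exact (ν l)) (hne : Pairwise fun i j => ∃ x ≠ 0, ν i x ≠ ν j x) :
    (r : ℝ) ≤ F.bound := by
  have hpi := AbsoluteValue.exists_one_lt_lt_one_pi_of_not_isEquiv
    (v := fun i => (ν i).absoluteValue) (fun i => by
      refine ⟨algebraMap R K (F.x ⟨0, hd⟩), F.x_ne' _, ?_⟩
      rw [(ν i).absoluteValue_apply (F.x_ne' _), hν i]
      have := F.lam_pos ⟨0, hd⟩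
      rw [Ne, Real.exp_eq_one_iff]
      linarith)
    (fun i j hij => by
      obtain ⟨x, hx, hx'⟩ := hne hij
      exact not_isEquiv hd (hν i) (hν j) hx hx')
  choose h hh1 hh2 using hpi
  have hh0 : ∀ i, h i ≠ 0 := by
    intro i h0
    have := hh1 i
    rw [h0, map_zero] at this
    linarith
  have hneg : ∀ i, ν i (h i) < 0 := by
    intro i
    have := hh1 i
    rw [(ν i).absoluteValue_apply (hh0 i), Real.one_lt_exp_iff] at this
    linarith
  have hpos : ∀ i, ∀ l ≠ i, 0 < ν l (h i) := by
    intro i l hl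
    have := hh2 i l hl
    rw [(ν l).absoluteValue_apply (hh0 i), Real.exp_lt_one_iff] at this
    linarith
  have hsum : ∀ i, h i + 1 ≠ 0 ∧ ν i (h i + 1) = ν i (h i) := fun i =>
    (ν i).map_add_eq_of_gt (hh0 i) fun _ => by rw [RVal.map_one]; exact hneg i
  have hsum' : ∀ i, ∀ l ≠ i, ν l (h i + 1) = 0 := fun i l hl => by
    have := ((ν l).map_add_eq_of_gt one_ne_zero (y := h i)
      fun _ => by rw [RVal.map_one]; exact hpos i l hl).2
    rwa [add_comm, RVal.map_one] at this
  set w : Fin r → K := fun i => h i / (h i + 1)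
  have hw0 : ∀ i, w i ≠ 0 := fun i => div_ne_zero (hh0 i) (hsum i).1
  have hwi : ∀ i, ν i (w i) = 0 := fun i => by
    rw [RVal.map_div _ (hh0 i) (hsum i).1, (hsum i).2, sub_self]
  have hwl : ∀ i, ∀ l ≠ i, 0 < ν l (w i) := fun i l hl => by
    rw [RVal.map_div _ (hh0 i) (hsum i).1, hsum' i l hl, sub_zero]
    exact hpos i l hl
  obtain ⟨b, hb⟩ := IsLocalization.exist_integer_multiples_of_finite (nonZeroDivisors R) w
  choose u hu using hb
  have hb0 : algebraMap R K (b : R) ≠ 0 := algebraMap_ne (nonZeroDivisors.ne_zero b.2)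
  have hu' : ∀ i, algebraMap R K (u i) = algebraMap R K b * w i := fun i => by
    rw [hu, Algebra.smul_def]
  have hu0 : ∀ i, algebraMap R K (u i) ≠ 0 := fun i => by
    rw [hu']; exact mul_ne_zero hb0 (hw0 i)
  have hui : ∀ i, ν i (algebraMap R K (u i)) = ν i (algebraMap R K b) := fun i => by
    rw [hu', RVal.map_mul _ hb0 (hw0 i), hwi, add_zero]
  have hul : ∀ i, ∀ l ≠ i, ν l (algebraMap R K b) < ν l (algebraMap R K (u i)) := fun i l hl => by
    rw [hu', RVal.map_mul _ hb0 (hw0 i)]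
    linarith [hwl i l hl]
  refine card_le_bound ν hν (fun l => ν l (algebraMap R K b)) u (fun i l => ?_) ?_
  · by_cases hl : l = i
    · subst hl; exact fun _ => (hui l).ge
    · exact fun _ => (hul i l hl).le
  · rintro c ⟨i, hi⟩
    refine ⟨i, fun hmem => ?_⟩
    have hci : IsUnit (c i) := by simpa using hi
    obtain ⟨e, he⟩ := hci
    rw [← Finset.add_sum_erase _ _ (Finset.mem_univ i)] at hmem
    have h1 : ∑ j ∈ Finset.univ.erase i, c j * u j ∈ (ν i).ideal' (ν i (algebraMap R K b)) := by
      refine Ideal.sum_mem _ fun j hj => Ideal.mul_mem_left _ _ fun _ => ?_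
      exact hul j i (Finset.ne_of_mem_erase hj).symm
    have h2 := (Ideal.add_mem_iff_left _ h1).1 hmem
    rw [← he] at h2
    have h3 := (Ideal.unit_mul_mem_iff_mem _ e.isUnit).1 h2
    exact (h3 (hu0 i)).ne' (hui i)

end Frame

end FiniteFamilies

section RealHom

variable {A : Type*} [AddCommGroup A]

/-- A total cone with an order unit induces a real valued homomorphism. -/
theorem exists_addMonoidHom_real (P : A → Prop) (h0 : P 0) (hadd : ∀ a b, P a → P b → P (a + b))
    (htot : ∀ a, P a ∨ P (-a)) (u : A) (hu : ¬ P (-u)) (harch : ∀ a, ∃ n : ℕ, P (n • u - a)) :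
    ∃ φ : A →+ ℝ, φ u = 1 ∧ ∀ a, P a → 0 ≤ φ a := by
  have hnsmul : ∀ (n : ℕ) a, P a → P (n • a) := by
    intro n a ha
    induction n with
    | zero => simpa using h0
    | succ n ih => rw [succ_nsmul]; exact hadd _ _ ih ha
  have hPu : P u := by
    rcases htot u with h | h
    · exact h
    · exact absurd h hu
  have hzu : ∀ k : ℤ, P (k • u) → 0 ≤ k := by
    intro k hk
    by_contra! hneg
    obtain ⟨j, rfl⟩ : ∃ j : ℕ, k = -(j + 1 : ℤ) := ⟨(-k - 1).toNat, by omega⟩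
    refine hu ?_
    have h1 := hadd _ _ hk (hnsmul j u hPu)
    have h2 : -(j + 1 : ℤ) • u + j • u = -u := by
      rw [← natCast_zsmul, ← add_zsmul]; simp
    rwa [h2] at h1
  set S : A → Set ℝ := fun a =>
    {ρ | ∃ (p : ℤ) (q : ℕ), 0 < q ∧ ρ = p / q ∧ P (q • a - p • u)}
  have hcmp : ∀ a (p p' : ℤ) (q q' : ℕ), 0 < q → 0 < q' → P (q • a - p • u) →
      P (p' • u - q' • a) → (p : ℝ) / q ≤ p' / q' := by
    intro a p p' q q' hq hq' h1 h2
    have h3 := hzu (p' * q - p * q') (by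
      have h4 := hadd _ _ (hnsmul q' _ h1) (hnsmul q _ h2)
      refine cast (congrArg P ?_) h4
      simp only [← natCast_zsmul]
      module)
    have hq1 : (0 : ℝ) < q := by exact_mod_cast hq
    have hq2 : (0 : ℝ) < q' := by exact_mod_cast hq'
    rw [div_le_div_iff₀ hq1 hq2]
    have h5 : p * q' ≤ p' * q := by linarith
    exact_mod_cast h5
  have hne : ∀ a, (S a).Nonempty := by
    intro a
    obtain ⟨n, hn⟩ := harch (-a)
    refine ⟨_, -n, 1, one_pos, rfl, ?_⟩
    refine cast (congrArg P ?_) hn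
    simp only [← natCast_zsmul]
    module
  have hbdd : ∀ a, BddAbove (S a) := by
    intro a
    obtain ⟨n, hn⟩ := harch a
    refine ⟨n, ?_⟩
    rintro _ ⟨p, q, hq, rfl, h⟩
    have := hcmp a p n q 1 hq one_pos h (by simpa using hn)
    simpa using this
  set L : A → ℝ := fun a => sSup (S a)
  have hsuper : ∀ a b, L a + L b ≤ L (a + b) := by
    intro a b
    rw [← le_sub_iff_add_le]
    refine csSup_le (hne a) ?_
    rintro _ ⟨p, q, hq, rfl, h⟩
    rw [le_sub_comm]
    refine csSup_le (hne b) ?_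
    rintro _ ⟨p', q', hq', rfl, h'⟩
    rw [le_sub_iff_add_le]
    refine le_csSup (hbdd _) ⟨p' * q + p * q', q' * q, Nat.mul_pos hq' hq, ?_, ?_⟩
    · have hq1 : (0 : ℝ) < q := by exact_mod_cast hq
      have hq2 : (0 : ℝ) < q' := by exact_mod_cast hq'
      push_cast
      field_simp
    · have h4 := hadd _ _ (hnsmul q' _ h) (hnsmul q _ h')
      refine cast (congrArg P ?_) h4
      simp only [← natCast_zsmul]
      push_cast
      module
  have hL0 : L 0 = 0 := by
    refine le_antisymm (csSup_le (hne 0) ?_) (le_csSup (hbdd 0) ⟨0, 1, one_pos, by simp, by simpa⟩)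
    rintro _ ⟨p, q, hq, rfl, h⟩
    have := hzu (-p) (by simpa using h)
    have hq1 : (0 : ℝ) < q := by exact_mod_cast hq
    have hp : (p : ℝ) ≤ 0 := by exact_mod_cast (by omega : p ≤ 0)
    exact div_nonpos_of_nonpos_of_nonneg hp hq1.le
  have hneg : ∀ a, L (-a) = - L a := by
    intro a
    have h1 := hsuper a (-a)
    rw [add_neg_cancel, hL0] at h1
    refine le_antisymm (by linarith) ?_
    by_contra! hlt
    obtain ⟨ρ, h2, h3⟩ := exists_rat_btwn (show L a < - L (-a) by linarith)
    have hden : 0 < ρ.den := ρ.den_pos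
    have hρ : (ρ : ℝ) = ρ.num / ρ.den := by exact_mod_cast (Rat.num_div_den ρ).symm
    rcases htot (ρ.den • a - ρ.num • u) with h | h
    · exact h2.not_ge (le_csSup (hbdd a) ⟨_, _, hden, hρ, h⟩)
    · have : -(ρ : ℝ) ≤ L (-a) := le_csSup (hbdd _) ⟨-ρ.num, ρ.den, hden, by
        rw [hρ]; push_cast; ring, by
        refine cast (congrArg P ?_) h
        simp only [← natCast_zsmul]
        module⟩
      linarith
  have hL : ∀ a b, L (a + b) = L a + L b := by
    intro a b
    refine le_antisymm ?_ (hsuper a b)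
    have := hsuper (a + b) (-b)
    rw [add_neg_cancel_right, hneg] at this
    linarith
  refine ⟨⟨⟨L, hL0⟩, hL⟩, ?_, fun a ha => le_csSup (hbdd a) ⟨0, 1, one_pos, by simp, by simpa⟩⟩
  change L u = 1
  refine le_antisymm (csSup_le (hne u) ?_) (le_csSup (hbdd u) ⟨1, 1, one_pos, by simp, by simpa⟩)
  rintro _ ⟨p, q, hq, rfl, h⟩
  have h1 := hcmp u p 1 q 1 hq one_pos h (by simpa)
  simpa using h1

end RealHom

section Compat

variable {R K : Type*} [CommRing R] [IsLocalRing R] [Field K] [Algebra R K] {d : ℕ}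

namespace Frame

variable (F : Frame R d)

/-- The weight of an integral exponent. -/
def zwt (e : Fin d → ℤ) : ℝ := ∑ i, e i * F.lam i

theorem zwt_add (a b : Fin d → ℤ) : F.zwt (a + b) = F.zwt a + F.zwt b := by
  simp [zwt, add_mul, Finset.sum_add_distrib]

theorem zwt_neg (a : Fin d → ℤ) : F.zwt (-a) = - F.zwt a := by
  simp [zwt]

theorem zwt_zero : F.zwt 0 = 0 := by simp [zwt]

theorem zwt_single (i : Fin d) (n : ℤ) : F.zwt (Pi.single i n) = n * F.lam i := by
  unfold zwt
  rw [Finset.sum_eq_single i]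
  · simp
  · intro j _ hj; simp [hj]
  · simp

theorem zwt_natCast (a : Fin d → ℕ) : F.zwt (fun i => (a i : ℤ)) = F.wt a := by
  simp [zwt, wt]

variable (K) in
/-- The Laurent monomial of an integral exponent. -/
def zmono (e : Fin d → ℤ) : K := ∏ i, algebraMap R K (F.x i) ^ e i

theorem zmono_zero : F.zmono K 0 = 1 := by simp [zmono]

theorem zmono_natCast (a : Fin d → ℕ) :
    F.zmono K (fun i => (a i : ℤ)) = algebraMap R K (mono F.x a) := by
  simp [zmono, algebraMap_mono]

theorem zmono_single (i : Fin d) (n : ℤ) :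
    F.zmono K (Pi.single i n) = algebraMap R K (F.x i) ^ n := by
  unfold zmono
  rw [Finset.prod_eq_single i]
  · simp
  · intro j _ hj; simp [hj]
  · simp

variable [IsFractionRing R K]

theorem zmono_add (a b : Fin d → ℤ) : F.zmono K (a + b) = F.zmono K a * F.zmono K b := by
  unfold zmono
  rw [← Finset.prod_mul_distrib]
  exact Finset.prod_congr rfl fun i _ => zpow_add₀ (F.x_ne' i) _ _

theorem zmono_ne_zero (a : Fin d → ℤ) : F.zmono K a ≠ 0 :=
  Finset.prod_ne_zero_iff.2 fun i _ => zpow_ne_zero _ (F.x_ne' i)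

theorem zmono_neg (a : Fin d → ℤ) : F.zmono K (-a) = (F.zmono K a)⁻¹ := by
  refine eq_inv_of_mul_eq_one_left ?_
  rw [← zmono_add, neg_add_cancel, zmono_zero]

/-- A valuation ring containing `R` which orders the Laurent monomials by weight. -/
structure Compat (V : ValuationSubring K) : Prop where
  mem : ∀ r : R, algebraMap R K r ∈ V
  lt_one : ∀ e : Fin d → ℤ, 0 < F.zwt e → V.valuation (F.zmono K e) < 1

variable {F}

theorem Compat.lt {V : ValuationSubring K} (h : F.Compat V) {a b : Fin d → ℤ}
    (hab : F.zwt a < F.zwt b) : V.valuation (F.zmono K b) < V.valuation (F.zmono K a) := by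
  have h1 := h.lt_one (b + -a) (by rw [zwt_add, zwt_neg]; linarith)
  rw [zmono_add, zmono_neg, map_mul, map_inv₀] at h1
  have h2 : 0 < V.valuation (F.zmono K a) := by
    rw [zero_lt_iff]; simpa using F.zmono_ne_zero a
  rwa [← div_eq_mul_inv, div_lt_one₀ h2] at h1

/-- The elements of `R` of value at most `γ`. -/
def _root_.ValuationSubring.idealLE (V : ValuationSubring K) (hV : ∀ r : R, algebraMap R K r ∈ V)
    (γ : V.ValueGroup) : Ideal R where
  carrier := {r | V.valuation (algebraMap R K r) ≤ γ}
  add_mem' {a b} ha hb := by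
    rw [Set.mem_ofPred_eq, map_add]; exact V.valuation.map_add_le ha hb
  zero_mem' := by rw [Set.mem_ofPred_eq, map_zero, map_zero]; exact zero_le
  smul_mem' c x hx := by
    rw [Set.mem_ofPred_eq, smul_eq_mul, map_mul, map_mul]
    exact (mul_le_of_le_one_left' ((V.valuation_le_one_iff _).2 (hV c))).trans hx

/-- The elements of `R` of value less than `γ`. -/
def _root_.ValuationSubring.idealLT (V : ValuationSubring K) (hV : ∀ r : R, algebraMap R K r ∈ V)
    (γ : V.ValueGroup) (hγ : γ ≠ 0) : Ideal R where
  carrier := {r | V.valuation (algebraMap R K r) < γ}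
  add_mem' {a b} ha hb := by
    rw [Set.mem_ofPred_eq, map_add]; exact V.valuation.map_add_lt ha hb
  zero_mem' := by rw [Set.mem_ofPred_eq, map_zero, map_zero]; exact zero_lt_iff.2 hγ
  smul_mem' c x hx := by
    rw [Set.mem_ofPred_eq, smul_eq_mul, map_mul, map_mul]
    exact (mul_le_of_le_one_left' ((V.valuation_le_one_iff _).2 (hV c))).trans_lt hx

theorem Compat.lt_of_mem_pow {V : ValuationSubring K} (h : F.Compat V) (n : ℕ) :
    ∀ g ∈ F.J ^ n, ∀ e : Fin d → ℤ, F.zwt e < n * F.δ →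
      V.valuation (algebraMap R K g) < V.valuation (F.zmono K e) := by
  induction n with
  | zero =>
    intro g _ e he
    have h1 := h.lt (a := e) (b := 0) (by rw [zwt_zero]; simpa using he)
    rw [zmono_zero, map_one] at h1
    exact ((V.valuation_le_one_iff _).2 (h.mem g)).trans_lt h1
  | succ n ih =>
    intro g hg e he
    have hne : V.valuation (F.zmono K e) ≠ 0 := by simpa using F.zmono_ne_zero e
    have hle : F.J ^ (n + 1) ≤ V.idealLT h.mem _ hne := by
      rw [pow_succ']
      refine Ideal.mul_le.2 fun y hy b hb => ?_
      rw [← Ideal.mem_colonElem]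
      refine Ideal.span_le.2 ?_ hy
      rintro _ ⟨i, rfl⟩
      rw [SetLike.mem_coe, Ideal.mem_colonElem]
      change V.valuation _ < _
      have h1 := ih b hb (e + Pi.single i (-1)) (by
        rw [zwt_add, zwt_single]
        have := F.δ_le i
        push_cast at he ⊢
        linarith)
      rw [zmono_add, map_mul, zmono_single, zpow_neg_one, map_inv₀] at h1
      have h2 : 0 < V.valuation (algebraMap R K (F.x i)) := by
        rw [zero_lt_iff]; simpa using F.x_ne i
      rw [← div_eq_mul_inv, lt_div_iff₀ h2] at h1
      rwa [map_mul, map_mul, mul_comm]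
    exact hle hg

theorem Compat.archimedean [IsDomain R] [IsNoetherianRing R] (hd : 0 < d)
    (hdim : ringKrullDim R = d) {V : ValuationSubring K} (h : F.Compat V) {f : R} (hf : f ≠ 0) :
    ∃ n : ℕ, V.valuation (algebraMap R K (F.x ⟨0, hd⟩)) ^ n < V.valuation (algebraMap R K f) := by
  classical
  by_contra! hcon
  have hfa : ∀ e : Fin d → ℤ, V.valuation (algebraMap R K f) < V.valuation (F.zmono K e) := by
    intro e
    obtain ⟨n, hn⟩ := exists_nat_gt (F.zwt e / F.lam ⟨0, hd⟩)
    rw [div_lt_iff₀ (F.lam_pos _)] at hn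
    refine (hcon n).trans_lt ?_
    have := h.lt (a := e) (b := Pi.single ⟨0, hd⟩ (n : ℤ)) (by rw [zwt_single]; exact_mod_cast hn)
    rwa [zmono_single, zpow_natCast, map_pow] at this
  obtain ⟨c, hc⟩ := exists_colen_span_sup_le hdim hf
  obtain ⟨q, hq⟩ := exists_nat_gt (F.total / F.δ)
  rw [div_lt_iff₀ F.δ_pos] at hq
  have main : ∀ n : ℕ, 0 < n → n ^ d ≤ c * (F.s * (n * q)) ^ (d - 1) := by
    intro n hn
    set P : Finset (Fin d → ℕ) := Fintype.piFinset fun _ => Finset.range n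
    have hcard : P.card = n ^ d := by simp [P]
    have hne : ∀ a : Fin d → ℕ, V.valuation (algebraMap R K (mono F.x a)) ≠ 0 := fun a => by
      simpa using mono_ne_zero F.x_ne a
    have h1 := Ideal.le_colen_of_chain P F.wt
      (fun a => V.idealLE h.mem (V.valuation (algebraMap R K (mono F.x a))))
      (fun a => V.idealLT h.mem (V.valuation (algebraMap R K (mono F.x a))) (hne a)) 1
      (Ideal.span {f} ⊔ maximalIdeal R ^ (F.s * (n * q))) F.wt_inj.injOn
      (fun a _ => Ideal.colen_add_one_le_of_lt (SetLike.lt_iff_le_and_exists.2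
        ⟨fun r hr => le_of_lt (show V.valuation _ < _ from hr), mono F.x a,
          le_refl (V.valuation _), fun hlt => lt_irrefl (V.valuation _) hlt⟩))
      (fun a ha => by
        refine sup_le ((Ideal.span_singleton_le_iff_mem _).2 ?_) ?_
        · change V.valuation _ < _
          rw [← zmono_natCast]
          exact hfa _
        · rw [pow_mul]
          refine (Ideal.pow_right_mono F.pow_le _).trans fun g hg => ?_
          change V.valuation _ < _
          rw [← zmono_natCast]
          refine h.lt_of_mem_pow (n * q) g hg _ ?_
          rw [zwt_natCast]
          refine (F.wt_le_of_lt (n := n) fun i =>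
            Finset.mem_range.1 (Fintype.mem_piFinset.1 ha i)).trans_lt ?_
          have : (0 : ℝ) < n := by exact_mod_cast hn
          push_cast
          rw [mul_assoc]
          gcongr)
      (fun a _ b _ hab g hg => by
        change V.valuation _ < _
        refine lt_of_le_of_lt (show V.valuation (algebraMap R K g) ≤
          V.valuation (algebraMap R K (mono F.x b)) from hg) ?_
        rw [← zmono_natCast, ← zmono_natCast]
        exact h.lt (by rwa [zwt_natCast, zwt_natCast]))
    rw [hcard, one_mul] at h1
    exact_mod_cast h1.trans (hc _)
  obtain ⟨D, hD⟩ : ∃ D, D = c * (F.s * q) ^ (d - 1) := ⟨_, rfl⟩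
  have h2 := main (D + 1) (Nat.succ_pos _)
  have h3 : c * (F.s * ((D + 1) * q)) ^ (d - 1) = D * (D + 1) ^ (d - 1) := by
    rw [hD, mul_left_comm F.s, mul_pow]; ring
  rw [h3] at h2
  have h4 : (D + 1) ^ d = (D + 1) * (D + 1) ^ (d - 1) := by
    rw [← pow_succ']; congr 1; omega
  rw [h4] at h2
  have h5 := Nat.le_of_mul_le_mul_right h2 (by positivity)
  omega

theorem Compat.exists_exact [IsDomain R] [IsNoetherianRing R] (hd : 0 < d)
    (hdim : ringKrullDim R = d) {V : ValuationSubring K} (h : F.Compat V) :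
    ∃ ν : RVal R K, F.Exact ν ∧ ∀ y ∈ V, y ≠ 0 → 0 ≤ ν y := by
  set x := algebraMap R K (F.x ⟨0, hd⟩) with hx
  have hx0 : x ≠ 0 := F.x_ne' _
  have hxlt : V.valuation x < 1 := by
    have := h.lt_one (Pi.single ⟨0, hd⟩ 1) (by rw [zwt_single]; simpa using F.lam_pos _)
    rwa [zmono_single, zpow_one] at this
  set u : Kˣ := Units.mk0 x hx0 with hu
  obtain ⟨φ, hφu, hφ⟩ := exists_addMonoidHom_real (A := Additive Kˣ)
    (fun a => ((a.toMul : Kˣ) : K) ∈ V) V.one_mem (fun a b ha hb => V.mul_mem _ _ ha hb)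
    (fun a => by
      have := V.mem_or_inv_mem ((a.toMul : Kˣ) : K)
      simpa using this)
    (Additive.ofMul u) (fun hmem => by
      have h1 : x⁻¹ ∈ V := by simpa [hu] using hmem
      rw [← V.valuation_le_one_iff, map_inv₀] at h1
      have h2 : 0 < V.valuation x := zero_lt_iff.2 (by simpa using hx0)
      exact h1.not_gt ((one_lt_inv₀ h2).2 hxlt))
    (fun a => by
      obtain ⟨y, rfl⟩ := Additive.ofMul.surjective a
      obtain ⟨f, g, hg, hfg⟩ := IsFractionRing.div_surjective (A := R) (y : K)
      have hf0 : f ≠ 0 := by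
        rintro rfl
        rw [map_zero, zero_div] at hfg
        exact y.ne_zero hfg.symm
      have hg0 : algebraMap R K g ≠ 0 := algebraMap_ne (nonZeroDivisors.ne_zero hg)
      obtain ⟨n, hn⟩ := h.archimedean hd hdim hf0
      refine ⟨n, ?_⟩
      have h1 : x ^ n / (y : K) ∈ V := by
        rw [← hfg, div_div_eq_mul_div, mul_comm, mul_div_assoc]
        refine V.mul_mem _ _ (h.mem g) ?_
        rw [← V.valuation_le_one_iff, map_div₀, map_pow]
        exact div_le_one_of_le₀ hn.le zero_le
      simpa [hu] using h1)
  set ν : K → ℝ := fun y => open Classical in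
    if hy : y = 0 then 0 else F.lam ⟨0, hd⟩ * φ (Additive.ofMul (Units.mk0 y hy))
  have hνdef : ∀ y (hy : y ≠ 0), ν y = F.lam ⟨0, hd⟩ * φ (Additive.ofMul (Units.mk0 y hy)) :=
    fun y hy => dif_neg hy
  have hνV : ∀ y ∈ V, y ≠ 0 → 0 ≤ ν y := fun y hy hy0 => by
    rw [hνdef y hy0]
    exact mul_nonneg (F.lam_pos _).le (hφ _ hy)
  have hνmul : ∀ y z, y ≠ 0 → z ≠ 0 → ν (y * z) = ν y + ν z := fun y z hy hz => by
    rw [hνdef _ hy, hνdef _ hz, hνdef _ (mul_ne_zero hy hz), ← mul_add, ← map_add, ← ofMul_mul,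
      Units.mk0_mul]
  have key : ∀ y z, y ≠ 0 → z ≠ 0 → y + z ≠ 0 → y / z ∈ V → ν z ≤ ν (y + z) := by
    intro y z hy hz hyz hV
    have h1 : (y + z) / z ∈ V := by
      rw [add_div, div_self hz]; exact V.add_mem _ _ hV V.one_mem
    have h2 := hνmul _ _ (div_ne_zero hyz hz) hz
    rw [div_mul_cancel₀ _ hz] at h2
    linarith [hνV _ h1 (div_ne_zero hyz hz)]
  let νr : RVal R K :=
    { toFun := ν
      map_mul' := hνmul
      map_add' := fun y z hy hz hyz => by
        rcases V.mem_or_inv_mem (y / z) with hV | hV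
        · exact (min_le_right _ _).trans (key y z hy hz hyz hV)
        · rw [inv_div] at hV
          rw [add_comm]
          exact (min_le_left _ _).trans (key z y hz hy (by rwa [add_comm]) hV)
      nonneg' := fun r hr => hνV _ (h.mem r) hr }
  refine ⟨νr, fun i => ?_, hνV⟩
  have hνx : νr x = F.lam ⟨0, hd⟩ := by
    change ν x = _
    rw [hνdef x hx0, ← hu, hφu, mul_one]
  have hmem : ∀ e, 0 < F.zwt e → 0 ≤ νr (F.zmono K e) := fun e he =>
    hνV _ ((V.valuation_le_one_iff _).1 (h.lt_one e he).le) (F.zmono_ne_zero e)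
  have hval : ∀ p q : ℤ, νr (F.zmono K (Pi.single i q + Pi.single ⟨0, hd⟩ p))
      = q * νr (algebraMap R K (F.x i)) + p * F.lam ⟨0, hd⟩ := by
    intro p q
    rw [zmono_add, zmono_single, zmono_single, νr.map_mul (zpow_ne_zero _ (F.x_ne' i))
      (zpow_ne_zero _ hx0), νr.map_zpow (F.x_ne' i), νr.map_zpow hx0, hνx]
  have hl := F.lam_pos ⟨0, hd⟩
  set y := νr (algebraMap R K (F.x i))
  by_contra hne
  rcases lt_or_gt_of_ne hne with hlt | hlt
  · obtain ⟨ρ, h1, h2⟩ := exists_rat_btwn (div_lt_div_of_pos_right hlt hl)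
    have hden : (0 : ℝ) < ρ.den := by exact_mod_cast ρ.den_pos
    have hρ : (ρ : ℝ) = ρ.num / ρ.den := by exact_mod_cast (Rat.num_div_den ρ).symm
    rw [hρ, div_lt_div_iff₀ hl hden] at h1
    rw [hρ, div_lt_div_iff₀ hden hl] at h2
    have h3 := hmem (Pi.single i (ρ.den : ℤ) + Pi.single ⟨0, hd⟩ (-ρ.num)) (by
      rw [zwt_add, zwt_single, zwt_single]; push_cast; linarith)
    rw [hval] at h3
    push_cast at h3
    linarith
  · obtain ⟨ρ, h1, h2⟩ := exists_rat_btwn (div_lt_div_of_pos_right hlt hl)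
    have hden : (0 : ℝ) < ρ.den := by exact_mod_cast ρ.den_pos
    have hρ : (ρ : ℝ) = ρ.num / ρ.den := by exact_mod_cast (Rat.num_div_den ρ).symm
    rw [hρ, div_lt_div_iff₀ hl hden] at h1
    rw [hρ, div_lt_div_iff₀ hden hl] at h2
    have h3 := hmem (Pi.single i (-ρ.den : ℤ) + Pi.single ⟨0, hd⟩ ρ.num) (by
      rw [zwt_add, zwt_single, zwt_single]; push_cast; linarith)
    rw [hval] at h3
    push_cast at h3
    linarith

end Frame

end Compat

section Dichotomy

variable {R K : Type*} [CommRing R] [IsLocalRing R] [Field K] [Algebra R K]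
  {d : ℕ}

namespace Frame

variable (F : Frame R d) (Y : R) (t : ℝ)

/-- The ideal generated by the products `x ^ a * Y ^ j` of weight at least that of
`x ^ c * Y ^ h`, where `Y` has weight `t`, which come before `x ^ c * Y ^ h`. -/
def relIdeal (h : ℕ) (c : Fin d → ℕ) : Ideal R :=
  Ideal.span {r | ∃ (j : ℕ) (a : Fin d → ℕ), r = mono F.x a * Y ^ j ∧ j ≤ h ∧
    F.wt c + h * t ≤ F.wt a + j * t ∧ (j < h ∨ F.wt c < F.wt a)}

/-- The element `x ^ c * Y ^ h`. -/
def top (h : ℕ) (c : Fin d → ℕ) : R := mono F.x c * Y ^ h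

variable {F Y t}

theorem top_mul_top (h h' : ℕ) (c c' : Fin d → ℕ) :
    F.top Y h c * F.top Y h' c' = F.top Y (h + h') (c + c') := by
  simp only [top, mono_add, pow_add]; ring

theorem relIdeal_mul_top {h h' : ℕ} {c c' : Fin d → ℕ} {r : R} (hr : r ∈ F.relIdeal Y t h c) :
    r * F.top Y h' c' ∈ F.relIdeal Y t (h + h') (c + c') := by
  rw [← Ideal.mem_colonElem]
  refine Ideal.span_le.2 ?_ hr
  rintro _ ⟨j, a, rfl, h1, h2, h3⟩
  rw [SetLike.mem_coe, Ideal.mem_colonElem]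
  refine Ideal.subset_span ⟨j + h', a + c', ?_, by omega, ?_, ?_⟩
  · simp only [top, mono_add, pow_add]; ring
  · simp only [wt_add]; push_cast; linarith
  · simp only [wt_add]
    exact h3.imp (fun h => by omega) fun h => by linarith

theorem relIdeal_mul_relIdeal {h h' : ℕ} {c c' : Fin d → ℕ} {r s : R}
    (hr : r ∈ F.relIdeal Y t h c) (hs : s ∈ F.relIdeal Y t h' c') :
    r * s ∈ F.relIdeal Y t (h + h') (c + c') := by
  rw [← Ideal.mem_colonElem]
  refine Ideal.span_le.2 ?_ hr
  rintro _ ⟨j, a, rfl, h1, h2, h3⟩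
  rw [SetLike.mem_coe, Ideal.mem_colonElem, mul_comm, ← Ideal.mem_colonElem]
  refine Ideal.span_le.2 ?_ hs
  rintro _ ⟨j', a', rfl, h1', h2', h3'⟩
  rw [SetLike.mem_coe, Ideal.mem_colonElem]
  refine Ideal.subset_span ⟨j + j', a + a', ?_, by omega, ?_, ?_⟩
  · simp only [mono_add, pow_add]; ring
  · simp only [wt_add]; push_cast; linarith
  · simp only [wt_add]
    by_cases hj : j < h
    · left; omega
    by_cases hj' : j' < h'
    · left; omega
    · right
      linarith [h3.resolve_left hj, h3'.resolve_left hj']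

theorem relIdeal_sup_mul {h h' : ℕ} {c c' : Fin d → ℕ} {I : Ideal R} {r s : R}
    (hr : r ∈ F.relIdeal Y t h c ⊔ I * Ideal.span {F.top Y h c})
    (hs : s ∈ F.relIdeal Y t h' c' ⊔ Ideal.span {F.top Y h' c'}) :
    r * s ∈ F.relIdeal Y t (h + h') (c + c') ⊔ I * Ideal.span {F.top Y (h + h') (c + c')} := by
  obtain ⟨r1, hr1, r2, hr2, rfl⟩ := Submodule.mem_sup.1 hr
  obtain ⟨s1, hs1, s2, hs2, rfl⟩ := Submodule.mem_sup.1 hs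
  rw [Ideal.mem_mul_span_singleton] at hr2
  obtain ⟨p, hp, rfl⟩ := hr2
  obtain ⟨q, rfl⟩ := Ideal.mem_span_singleton'.1 hs2
  have e : (r1 + p * F.top Y h c) * (s1 + q * F.top Y h' c')
      = (r1 * s1 + q * (r1 * F.top Y h' c') + p * (s1 * F.top Y h c))
        + (p * q) * F.top Y (h + h') (c + c') := by
    rw [← top_mul_top]; ring
  rw [e]
  refine Submodule.add_mem_sup (Ideal.add_mem _ (Ideal.add_mem _ (relIdeal_mul_relIdeal hr1 hs1)
    (Ideal.mul_mem_left _ _ (relIdeal_mul_top hr1))) (Ideal.mul_mem_left _ _ ?_))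
    (Ideal.mem_mul_span_singleton.2 ⟨_, I.mul_mem_right _ hp, rfl⟩)
  have := relIdeal_mul_top (h' := h) (c' := c) hs1
  rwa [add_comm h', add_comm c'] at this

variable (F Y t) in
/-- Elements of the fraction field which after multiplication by some `x ^ c * Y ^ h` lie in the
ideal of earlier elements plus the multiples of this element by `I`. -/
def Cleared (I : Ideal R) (v : K) : Prop :=
  ∃ (h : ℕ) (c : Fin d → ℕ), ∃ r ∈ F.relIdeal Y t h c ⊔ I * Ideal.span {F.top Y h c},
    v * algebraMap R K (F.top Y h c) = algebraMap R K r

theorem Cleared.mul {I : Ideal R} {v w : K} (hv : F.Cleared Y t I v) (hw : F.Cleared Y t ⊤ w) :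
    F.Cleared Y t I (v * w) := by
  obtain ⟨h, c, r, hr, hvr⟩ := hv
  obtain ⟨h', c', s, hs, hws⟩ := hw
  rw [Ideal.top_mul] at hs
  refine ⟨h + h', c + c', r * s, relIdeal_sup_mul hr hs, ?_⟩
  rw [map_mul, ← hvr, ← hws, ← top_mul_top, map_mul]; ring

theorem Cleared.add {I : Ideal R} {v w : K} (hv : F.Cleared Y t I v) (hw : F.Cleared Y t I w) :
    F.Cleared Y t I (v + w) := by
  obtain ⟨h, c, r, hr, hvr⟩ := hv
  obtain ⟨h', c', s, hs, hws⟩ := hw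
  have ht : ∀ h c, F.top Y h c ∈ F.relIdeal Y t h c ⊔ Ideal.span {F.top Y h c} := fun h c =>
    Ideal.mem_sup_right (Ideal.subset_span rfl)
  have h2 := relIdeal_sup_mul hs (ht h c)
  rw [add_comm h', add_comm c'] at h2
  refine ⟨h + h', c + c', r * F.top Y h' c' + s * F.top Y h c,
    Ideal.add_mem _ (relIdeal_sup_mul hr (ht h' c')) h2, ?_⟩
  rw [map_add, map_mul, map_mul, ← hvr, ← hws, ← top_mul_top, map_mul]; ring

theorem cleared_algebraMap {I : Ideal R} {r : R} (hr : r ∈ I) :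
    F.Cleared Y t I (algebraMap R K r) :=
  ⟨0, 0, r * F.top Y 0 0, Ideal.mem_sup_right (Ideal.mem_mul_span_singleton.2 ⟨r, hr, rfl⟩),
    by rw [map_mul]⟩

variable [IsFractionRing R K]

theorem cleared_zmono (I : Ideal R) {e : Fin d → ℤ} (he : 0 < F.zwt e) :
    F.Cleared Y t I (F.zmono K e) := by
  set c : Fin d → ℕ := fun i => (-e i).toNat
  set a : Fin d → ℕ := fun i => (e i).toNat
  have hac : (fun i => (a i : ℤ)) = e + fun i => (c i : ℤ) := by
    funext i; simp only [a, c, Pi.add_apply]; omega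
  refine ⟨0, c, mono F.x a, Ideal.mem_sup_left (Ideal.subset_span ⟨0, a, by simp, le_rfl, ?_⟩), ?_⟩
  · have h1 := F.zwt_natCast a
    rw [hac, zwt_add, zwt_natCast] at h1
    exact ⟨by linarith, Or.inr (by linarith)⟩
  · rw [← F.zmono_natCast a, hac, zmono_add, F.zmono_natCast]
    simp [top]

theorem cleared_div (I : Ideal R) (hY : Y ≠ 0) {b : Fin d → ℕ} (hb : t ≤ F.wt b) :
    F.Cleared Y t I (algebraMap R K (mono F.x b) / algebraMap R K Y) := by
  refine ⟨1, 0, mono F.x b, Ideal.mem_sup_left (Ideal.subset_span ⟨0, b, by simp, by simp, ?_⟩), ?_⟩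
  · simpa [wt_zero] using hb
  · have : algebraMap R K Y ≠ 0 := algebraMap_ne hY
    simp only [top, mono_zero, pow_one, one_mul]
    field_simp

/-- Either `x ^ b / Y` lies in a compatible valuation ring or there is a relation. -/
theorem exists_compat_or_rel (hY : Y ≠ 0) {b : Fin d → ℕ} (hb : t ≤ F.wt b) :
    (∃ V : ValuationSubring K, F.Compat V ∧
      algebraMap R K (mono F.x b) / algebraMap R K Y ∈ V) ∨
    ∃ (h : ℕ) (c : Fin d → ℕ), F.top Y h c ∈ F.relIdeal Y t h c := by
  set z := algebraMap R K (mono F.x b) / algebraMap R K Y with hz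
  set S : Set K := insert z {u | ∃ e, 0 < F.zwt e ∧ F.zmono K e = u} with hS
  have hScl : ∀ I, ∀ u ∈ S, F.Cleared Y t I u := by
    rintro I u (rfl | ⟨e, he, rfl⟩)
    · exact cleared_div I hY hb
    · exact cleared_zmono I he
  set A := (Algebra.adjoin R S).toSubring with hA
  have hAcl : ∀ u ∈ A, F.Cleared Y t ⊤ u := by
    intro u hu
    refine Algebra.adjoin_induction (fun u hu => hScl ⊤ u hu)
      (fun r => cleared_algebraMap trivial) (fun _ _ _ _ => Cleared.add)
      (fun _ _ _ _ => Cleared.mul) (show u ∈ Algebra.adjoin R S from hu)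
  set N : Ideal A := Ideal.span
    {u | (u : K) ∈ S ∨ ∃ r ∈ maximalIdeal R, algebraMap R K r = u} with hN
  have hSA : S ⊆ A := Algebra.subset_adjoin
  have hRA : ∀ r, algebraMap R K r ∈ A := fun r => (Algebra.adjoin R S).algebraMap_mem r
  by_cases htop : N = ⊤
  · right
    have hNcl : ∀ u ∈ N, F.Cleared Y t (maximalIdeal R) (u : K) := by
      intro u hu
      induction hu using Submodule.span_induction with
      | mem u hu =>
        rcases hu with hu | ⟨r, hr, hru⟩
        · exact hScl _ _ hu
        · rw [← hru]; exact cleared_algebraMap hr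
      | zero =>
        have := cleared_algebraMap (F := F) (Y := Y) (t := t) (K := K)
          (maximalIdeal R).zero_mem
        simpa using this
      | add u v _ _ hu hv => exact hu.add hv
      | smul a u _ hu =>
        rw [smul_eq_mul, mul_comm]
        exact hu.mul (hAcl _ a.2)
    obtain ⟨h, c, r, hr, hrc⟩ := hNcl 1 (by rw [htop]; trivial)
    have hrc' : F.top Y h c = r := by
      apply IsFractionRing.injective R K
      simpa using hrc
    obtain ⟨g, hg, q, hq, hgq⟩ := Submodule.mem_sup.1 hr
    rw [Ideal.mem_mul_span_singleton] at hq
    obtain ⟨μ, hμ, rfl⟩ := hq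
    refine ⟨h, c, ?_⟩
    have hunit : IsUnit (1 - μ) := by
      by_contra hnu
      have h1 : 1 - μ ∈ maximalIdeal R := hnu
      have h2 := Ideal.add_mem _ h1 hμ
      rw [sub_add_cancel] at h2
      exact (Ideal.ne_top_iff_one _).1 (maximalIdeal.isMaximal R).ne_top h2
    rw [← Ideal.unit_mul_mem_iff_mem _ hunit]
    have : (1 - μ) * F.top Y h c = g := by
      rw [← hrc'] at hgq
      linear_combination -hgq
    rwa [this]
  · left
    obtain ⟨V, hAV, hNV⟩ := Ideal.image_subset_nonunits_valuationSubring N htop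
    refine ⟨V, ⟨fun r => hAV (hRA r), fun e he => ?_⟩, hAV (hSA (Or.inl rfl))⟩
    have hmem : F.zmono K e ∈ S := Or.inr ⟨e, he, rfl⟩
    exact V.mem_nonunits_iff.1
      (hNV ⟨⟨_, hSA hmem⟩, Ideal.subset_span (Or.inl hmem), rfl⟩)

end Frame

end Dichotomy

section Relation

theorem Ideal.mem_sup_span_image_mono {R : Type*} [CommRing R] {ι : Type*} {M : Ideal R}
    {g : ι → R} {A B : Set ι} (h : A ⊆ B) {r : R} (hr : r ∈ M ⊔ Ideal.span (g '' A)) :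
    r ∈ M ⊔ Ideal.span (g '' B) :=
  sup_le (a := M) le_sup_left (le_sup_of_le_right (Ideal.span_mono (Set.image_mono h))) hr

variable {R : Type*} [CommRing R] [IsLocalRing R] {d : ℕ}

namespace Frame

variable (F : Frame R d) (Y : R) (t : ℝ)

theorem J_pow_le_span (n : ℕ) : F.J ^ n ≤
    Ideal.span {r | ∃ a, r = mono F.x a ∧ n * F.δ ≤ F.wt a} := by
  induction n with
  | zero =>
    rw [pow_zero, Ideal.one_eq_top, top_le_iff, Ideal.eq_top_iff_one]
    exact Ideal.subset_span ⟨0, (mono_zero _).symm, by simp [wt_zero]⟩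
  | succ n ih =>
    rw [pow_succ']
    refine Ideal.mul_le.2 fun y hy b hb => ?_
    rw [← Ideal.mem_colonElem]
    refine Ideal.span_le.2 ?_ hy
    rintro _ ⟨i, rfl⟩
    rw [SetLike.mem_coe, Ideal.mem_colonElem, mul_comm (F.x i), ← Ideal.mem_colonElem]
    refine Ideal.span_le.2 ?_ (ih hb)
    rintro _ ⟨a, rfl, ha⟩
    rw [SetLike.mem_coe, Ideal.mem_colonElem, mul_comm (mono F.x a), ← mono_add_single]
    refine Ideal.subset_span ⟨_, rfl, ?_⟩
    have := F.δ_le i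
    rw [wt_add, wt_single]
    push_cast
    linarith

/-- The ideal generated by the products `x ^ a * Y ^ j` with `j < h` of weight at least `τ`. -/
def lowIdeal (h : ℕ) (τ : ℝ) : Ideal R :=
  Ideal.span {r | ∃ (j : ℕ) (a : Fin d → ℕ), r = mono F.x a * Y ^ j ∧ j < h ∧ τ ≤ F.wt a + j * t}

/-- The exponents of weight about `k * t` which are not reduced by a relation with leading
exponent `(h, c)`. -/
noncomputable def goodSet (h : ℕ) (c : Fin d → ℕ) (k N : ℕ) : Finset (ℕ × (Fin d → ℕ)) :=
  open Classical in
  ((Finset.range (k + 1)) ×ˢ (Fintype.piFinset fun _ => Finset.range N)).filter fun p =>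
    h ≤ p.1 ∧ ¬ c ≤ p.2 ∧ k * t ≤ F.wt p.2 + p.1 * t ∧ F.wt p.2 + p.1 * t < k * t + t

variable {F Y t}

theorem lt_of_wt_lt {N : ℕ} {τ : ℝ} (hN : τ ≤ N * F.δ) {a : Fin d → ℕ} (ha : F.wt a < τ)
    (i : Fin d) : a i < N := by
  have h1 := (F.mul_le_wt a i).trans_lt (ha.trans_le hN)
  exact_mod_cast lt_of_mul_lt_mul_right h1 F.δ_pos.le

theorem mono_mul_pow_mem (ht : 0 < t) {h : ℕ} (hh : 0 < h) {c : Fin d → ℕ}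
    (hrel : F.top Y h c ∈ F.relIdeal Y t h c) {k N : ℕ} (hN : k * t + t ≤ N * F.δ) (M : ℕ) :
    ∀ (i : ℕ) (a : Fin d → ℕ), i ≤ k → k * t ≤ F.wt a + i * t →
      {b : Fin d → ℕ | F.wt a ≤ F.wt b ∧ F.wt b < k * t + t}.ncard ≤ M →
      mono F.x a * Y ^ i ∈ F.lowIdeal Y t h (k * t) ⊔
        Ideal.span ((fun p : ℕ × (Fin d → ℕ) => mono F.x p.2 * Y ^ p.1) ''
          {p | p ∈ F.goodSet t h c k N ∧ F.wt a ≤ F.wt p.2}) := by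
  classical
  induction M using Nat.strong_induction_on with
  | _ M ihM =>
  intro i
  induction i with
  | zero =>
    intro a _ ha _
    exact Ideal.mem_sup_left (Ideal.subset_span ⟨0, a, rfl, hh, ha⟩)
  | succ i ih =>
    intro a hik ha hM
    by_cases h1 : i + 1 < h
    · exact Ideal.mem_sup_left (Ideal.subset_span ⟨i + 1, a, rfl, h1, ha⟩)
    by_cases h2 : k * t + t ≤ F.wt a + (i + 1 : ℕ) * t
    · rw [pow_succ, ← mul_assoc]
      refine Ideal.mul_mem_right _ _ (ih a (by omega) ?_ hM)
      push_cast at h2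
      linarith
    rw [not_le] at h2
    have hit : 0 ≤ ((i + 1 : ℕ) : ℝ) * t := by positivity
    have haN : F.wt a < k * t + t := by linarith
    by_cases h3 : c ≤ a
    · have hmem : mono F.x a * Y ^ (i + 1) ∈ F.relIdeal Y t (i + 1) a := by
        have := relIdeal_mul_top (h' := i + 1 - h) (c' := a - c) hrel
        rw [top_mul_top, add_tsub_cancel_of_le h3, add_tsub_cancel_of_le (not_lt.1 h1)] at this
        exact this
      refine Ideal.span_le.2 ?_ hmem
      rintro _ ⟨j, a', rfl, h4, h5, h6⟩
      have hlt : F.wt a < F.wt a' := by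
        rcases h6 with h6 | h6
        · have : ((j : ℝ) + 1) ≤ (i + 1 : ℕ) := by exact_mod_cast h6
          nlinarith
        · exact h6
      have hfin : {b : Fin d → ℕ | F.wt a ≤ F.wt b ∧ F.wt b < k * t + t}.Finite := by
        refine (Fintype.piFinset fun _ : Fin d => Finset.range N).finite_toSet.subset ?_
        rintro b ⟨-, hb⟩
        exact Fintype.mem_piFinset.2 fun i => Finset.mem_range.2 (lt_of_wt_lt hN hb i)
      have hcard : {b : Fin d → ℕ | F.wt a' ≤ F.wt b ∧ F.wt b < k * t + t}.ncard < M := by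
        refine lt_of_lt_of_le (Set.ncard_lt_ncard ?_ hfin) hM
        refine ⟨fun b hb => ⟨hlt.le.trans hb.1, hb.2⟩, fun hsub => ?_⟩
        exact (hsub (show a ∈ _ from ⟨le_rfl, haN⟩)).1.not_gt hlt
      refine Ideal.mem_sup_span_image_mono ?_
        (ihM _ hcard j a' (h4.trans hik) (ha.trans h5) le_rfl)
      exact fun p hp => ⟨hp.1, hlt.le.trans hp.2⟩
    · refine Ideal.mem_sup_right (Ideal.subset_span ⟨(i + 1, a), ⟨?_, le_rfl⟩, rfl⟩)
      refine Finset.mem_filter.2 ⟨Finset.mem_product.2 ⟨Finset.mem_range.2 (by omega),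
        Fintype.mem_piFinset.2 fun l => Finset.mem_range.2 (lt_of_wt_lt hN haN l)⟩,
        not_lt.1 h1, h3, ha, h2⟩

variable (F) in
theorem card_goodSet_le (ht : 0 < t) (h : ℕ) (c : Fin d → ℕ) (k N : ℕ) :
    (F.goodSet t h c k N).card ≤ (∑ l, c l) * N ^ (d - 1) := by
  classical
  have hinj : Set.InjOn Prod.snd (F.goodSet t h c k N : Set (ℕ × (Fin d → ℕ))) := by
    rintro ⟨i, a⟩ hi ⟨j, b⟩ hj rfl
    obtain ⟨-, -, -, h1, h2⟩ := Finset.mem_filter.1 (Finset.mem_coe.1 hi)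
    obtain ⟨-, -, -, h3, h4⟩ := Finset.mem_filter.1 (Finset.mem_coe.1 hj)
    simp only at h1 h2 h3 h4
    have h5 : (i : ℝ) * t < (j + 1) * t := by linarith
    have h6 : (j : ℝ) * t < (i + 1) * t := by linarith
    have h7 : i < j + 1 := by exact_mod_cast lt_of_mul_lt_mul_right h5 ht.le
    have h8 : j < i + 1 := by exact_mod_cast lt_of_mul_lt_mul_right h6 ht.le
    exact Prod.ext (by simp only; omega) rfl
  rw [← Finset.card_image_of_injOn hinj]
  have hsub : (F.goodSet t h c k N).image Prod.snd ⊆ Finset.univ.biUnion fun l : Fin d =>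
      Fintype.piFinset (Function.update (fun _ => Finset.range N) l (Finset.range (c l))) := by
    intro a ha
    obtain ⟨⟨j, a⟩, hp, rfl⟩ := Finset.mem_image.1 ha
    obtain ⟨h0, -, h1, -⟩ := Finset.mem_filter.1 hp
    have h2 := Fintype.mem_piFinset.1 (Finset.mem_product.1 h0).2
    obtain ⟨l, hl⟩ := not_forall.1 h1
    refine Finset.mem_biUnion.2 ⟨l, Finset.mem_univ _, Fintype.mem_piFinset.2 fun i => ?_⟩
    by_cases hil : i = l
    · subst hil
      rw [Function.update_self]
      exact Finset.mem_range.2 (not_le.1 hl)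
    · rw [Function.update_of_ne hil]
      exact h2 i
  refine (Finset.card_le_card hsub).trans (Finset.card_biUnion_le.trans ?_)
  rw [Finset.sum_mul]
  refine Finset.sum_le_sum fun l _ => le_of_eq ?_
  rw [Fintype.card_piFinset, Fintype.prod_eq_mul_prod_compl l, Function.update_self,
    Finset.card_range]
  congr 1
  rw [Finset.prod_congr rfl (g := fun _ => N) fun i hi => ?_, Finset.prod_const,
    Finset.card_compl, Finset.card_singleton, Fintype.card_fin]
  rw [Function.update_of_ne (by simpa using hi), Finset.card_range]

variable {K : Type*} [Field K] [Algebra R K] [IsFractionRing R K]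

theorem colonElem_lowIdeal_le {v : RVal R K} (hv : F.Adapted v) (hY : Y ≠ 0) (h : ℕ) (k : ℕ)
    (ht : 0 < t) {s : ℝ} (hs : s ≤ k * t - h * t - k * v (algebraMap R K Y)) :
    (F.lowIdeal Y t h (k * t)).colonElem (Y ^ k) ≤ v.ideal s := by
  have h1 : F.lowIdeal Y t h (k * t) ≤ v.ideal (k * t - h * t) := by
    refine Ideal.span_le.2 ?_
    rintro _ ⟨j, a, rfl, hj, ha⟩
    rw [SetLike.mem_coe, v.mem_ideal, map_mul]
    have h2 := RVal.GE.mul (s := F.wt a) (fun _ => hv.le_mono a) (v.ge_algebraMap (Y ^ j))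
    refine RVal.GE.mono ?_ h2
    have : (j : ℝ) * t ≤ h * t := by
      have : (j : ℝ) ≤ h := by exact_mod_cast hj.le
      gcongr
    linarith
  intro g hg hg0
  rw [Ideal.mem_colonElem] at hg
  have hY' : algebraMap R K Y ≠ 0 := algebraMap_ne hY
  have h2 := h1 hg
  rw [v.mem_ideal, map_mul, map_pow] at h2
  have h3 := h2 (mul_ne_zero hg0 (pow_ne_zero _ hY'))
  rw [v.map_mul hg0 (pow_ne_zero _ hY'), v.map_pow hY'] at h3
  linarith

variable [IsNoetherianRing R]

theorem colen_colonElem_lowIdeal_le (ht : 0 < t) {h : ℕ} (hh : 0 < h) {c : Fin d → ℕ}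
    (hrel : F.top Y h c ∈ F.relIdeal Y t h c) {k N : ℕ} (hN : k * t + t ≤ N * F.δ) :
    ((F.lowIdeal Y t h (k * t)).colonElem (Y ^ k)).colen
      ≤ (((∑ l, c l) * N ^ (d - 1)) * F.J.colen.toNat : ℕ) := by
  classical
  set M := F.lowIdeal Y t h (k * t) with hM
  set g := fun p : ℕ × (Fin d → ℕ) => mono F.x p.2 * Y ^ p.1 with hg
  set P := F.goodSet t h c k N with hP
  have key := fun i a h1 h2 => mono_mul_pow_mem ht hh hrel hN _ i a h1 h2 le_rfl
  have hchain := Ideal.colen_le_of_chain P (fun p => F.wt p.2) g M F.J (fun p hp y hy => by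
    rw [← Ideal.mem_colonElem]
    refine Ideal.span_le.2 ?_ hy
    rintro _ ⟨l, rfl⟩
    obtain ⟨h0, -, -, h1, -⟩ := Finset.mem_filter.1 hp
    rw [SetLike.mem_coe, Ideal.mem_colonElem, hg]
    simp only
    rw [← mul_assoc, ← mono_add_single]
    have hl := F.lam_pos l
    have hwt : F.wt (p.2 + Pi.single l 1) = F.wt p.2 + F.lam l := by
      rw [wt_add, wt_single]; simp
    refine Ideal.mem_sup_span_image_mono ?_
      (key p.1 (p.2 + Pi.single l 1) ?_ ?_)
    · rintro q ⟨h2, h3⟩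
      exact ⟨h2, by linarith⟩
    · have := Finset.mem_range.1 (Finset.mem_product.1 h0).1
      omega
    · linarith)
  have hY : Y ^ k ∈ M ⊔ Ideal.span (g '' P) := by
    have := key k 0 le_rfl (by rw [wt_zero, zero_add])
    rw [mono_zero, one_mul] at this
    exact Ideal.mem_sup_span_image_mono (fun p hp => hp.1) this
  have hfin : (M ⊔ Ideal.span {Y ^ k}).colen ≠ ⊤ := by
    refine Ideal.colen_ne_top_of_pow_le (k := F.s * N) ?_
    refine le_sup_of_le_left ?_
    rw [pow_mul]
    refine (Ideal.pow_right_mono F.pow_le _).trans ((F.J_pow_le_span N).trans ?_)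
    refine Ideal.span_mono ?_
    rintro _ ⟨a, rfl, ha⟩
    exact ⟨0, a, by simp, hh, by simp only [Nat.cast_zero, zero_mul]; linarith⟩
  have h1 : (M ⊔ Ideal.span (g '' P)).colen ≤ (M ⊔ Ideal.span {Y ^ k}).colen :=
    Ideal.colen_anti (sup_le le_sup_left ((Ideal.span_singleton_le_iff_mem _).2 hY))
  rw [M.colen_eq_add (Y ^ k), add_comm] at hchain
  have h2 : (M.colonElem (Y ^ k)).colen ≤ (P.card : ℕ∞) * F.J.colen :=
    (WithTop.add_le_add_iff_left hfin).1
    (hchain.trans (add_le_add_left h1 _))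
  refine h2.trans ?_
  have hJ : F.J.colen = (F.J.colen.toNat : ℕ) :=
    (ENat.natCast_toNat (Ideal.colen_ne_top_of_pow_le F.pow_le)).symm
  rw [hJ, ENat.toNat_natCast, ← Nat.cast_mul]
  have h3 := Nat.mul_le_mul_right F.J.colen.toNat (F.card_goodSet_le ht h c k N)
  exact Nat.cast_le.2 h3

theorem colen_ideal_le_of_rel {v : RVal R K} (hv : F.Adapted v) (hY : Y ≠ 0) (ht : 0 < t)
    {h : ℕ} {c : Fin d → ℕ} (hrel : F.top Y h c ∈ F.relIdeal Y t h c)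
    (hvY : v (algebraMap R K Y) ≤ t / 2) :
    ∃ C : ℕ, ∀ n : ℕ, (v.ideal n).colen ≤ (C * (n + 1) ^ (d - 1) : ℕ) := by
  have hrel' := relIdeal_mul_top (h' := 1) (c' := 0) hrel
  rw [top_mul_top] at hrel'
  obtain ⟨q, hq⟩ := exists_nat_ge (t / F.δ)
  rw [div_le_iff₀ F.δ_pos] at hq
  obtain ⟨p, hp⟩ := exists_nat_ge (2 / t + 2 * (h + 1))
  refine ⟨(∑ l, (c + 0) l) * ((p + 1) * q) ^ (d - 1) * F.J.colen.toNat, fun n => ?_⟩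
  have hN : ((p * (n + 1) : ℕ) : ℝ) * t + t ≤ (((p + 1) * (n + 1) * q : ℕ) : ℝ) * F.δ := by
    have h1 : ((p * (n + 1) : ℕ) : ℝ) + 1 ≤ ((p + 1) * (n + 1) : ℕ) := by
      norm_cast; nlinarith
    calc ((p * (n + 1) : ℕ) : ℝ) * t + t = (((p * (n + 1) : ℕ) : ℝ) + 1) * t := by ring
      _ ≤ ((p + 1) * (n + 1) : ℕ) * (q * F.δ) := by gcongr
      _ = _ := by push_cast; ring
  refine (Ideal.colen_anti (colonElem_lowIdeal_le hv hY (h + 1) (p * (n + 1)) ht ?_)).trans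
    ((colen_colonElem_lowIdeal_le ht (Nat.succ_pos h) hrel' hN).trans (le_of_eq ?_))
  · have h1 : ((p * (n + 1) : ℕ) : ℝ) * v (algebraMap R K Y) ≤ (p * (n + 1) : ℕ) * (t / 2) := by
      gcongr
    have h2 : (2 / t + 2 * (h + 1)) * (n + 1) * (t / 2) ≤ p * (n + 1) * (t / 2) := by gcongr
    have h3 : (2 / t + 2 * (h + 1)) * (n + 1) * (t / 2) = (n + 1) * (1 + (h + 1) * t) := by
      field_simp
    have h4 : (0 : ℝ) ≤ n * ((h + 1) * t) := by positivity
    push_cast at h1 ⊢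
    linarith
  · rw [show (p + 1) * (n + 1) * q = (p + 1) * q * (n + 1) by ring, mul_pow _ (n + 1)]
    congr 1
    ring

end Frame

end Relation

section Selection

variable {R K : Type*} [CommRing R] [IsLocalRing R] [Field K] [Algebra R K] {d : ℕ}

namespace Frame

variable {F : Frame R d} [IsFractionRing R K] [IsDomain R] [IsNoetherianRing R]

theorem exists_finite_exact (F : Frame R d) (hd : 0 < d) :
    ∃ (r : ℕ) (ν : Fin r → RVal R K), (∀ i, F.Exact (ν i)) ∧
      ∀ μ : RVal R K, F.Exact μ → ∃ i, ∀ x ≠ 0, μ x = ν i x := by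
  classical
  let P : ℕ → Prop := fun r => ∃ ν : Fin r → RVal R K, (∀ i, F.Exact (ν i)) ∧
    Pairwise fun i j => ∃ x ≠ 0, ν i x ≠ ν j x
  obtain ⟨r, ⟨ν, hν, hne⟩, hr⟩ : ∃ r, P r ∧ ¬ P (r + 1) := by
    by_contra! hcon
    have hall : ∀ r, P r := fun r => by
      induction r with
      | zero => exact ⟨fun i => i.elim0, fun i => i.elim0, fun i => i.elim0⟩
      | succ r ih => exact hcon r ih
    obtain ⟨N, hN⟩ := exists_nat_gt F.bound
    obtain ⟨ν, hν, hne⟩ := hall N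
    exact hN.not_ge (card_family_le hd ν hν hne)
  refine ⟨r, ν, hν, fun μ hμ => ?_⟩
  by_contra! hcon
  refine hr ⟨Fin.cons μ ν, fun i => ?_, fun i j hij => ?_⟩
  · refine Fin.cases ?_ (fun i => ?_) i
    · exact hμ
    · exact hν i
  · induction i using Fin.cases with
    | zero =>
      induction j using Fin.cases with
      | zero => exact absurd rfl hij
      | succ j => exact hcon j
    | succ i =>
      induction j using Fin.cases with
      | zero =>
        obtain ⟨x, hx, h⟩ := hcon i
        exact ⟨x, hx, h.symm⟩
      | succ j => exact hne fun h => hij (congrArg Fin.succ h)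

theorem exists_exact_le_or_colen_le (hd : 0 < d) (hdim : ringKrullDim R = d) {v : RVal R K}
    (hv : F.Adapted v) :
    (∃ ν : RVal R K, F.Exact ν ∧ ∃ C : ℝ, 0 < C ∧
      ∀ f : R, f ≠ 0 → ν (algebraMap R K f) ≤ C * v (algebraMap R K f)) ∨
    ∃ C : ℕ, ∀ n : ℕ, (v.ideal n).colen ≤ (C * (n + 1) ^ (d - 1) : ℕ) := by
  by_cases hcon : ∃ ν : RVal R K, F.Exact ν ∧ ∃ C : ℝ, 0 < C ∧
      ∀ f : R, f ≠ 0 → ν (algebraMap R K f) ≤ C * v (algebraMap R K f)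
  · exact Or.inl hcon
  right
  push Not at hcon
  obtain ⟨r, ν, hν, hall⟩ := F.exists_finite_exact (K := K) hd
  choose f hf0 hf using fun i => hcon (ν i) (hν i) (4 * (r + 1)) (by positivity)
  have hf0' : ∀ i, algebraMap R K (f i) ≠ 0 := fun i => algebraMap_ne (hf0 i)
  have hvf : ∀ i, 0 ≤ v (algebraMap R K (f i)) := fun i => v.nonneg' _ (hf0' i)
  have hα : ∀ i, 0 < ν i (algebraMap R K (f i)) := fun i =>
    lt_of_le_of_lt (mul_nonneg (by positivity) (hvf i)) (hf i)
  have hl := F.lam_pos ⟨0, hd⟩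
  obtain ⟨N, hN⟩ := exists_nat_gt (4 * (∑ i, v (algebraMap R K (f i))) / F.lam ⟨0, hd⟩)
  have hS : 0 ≤ ∑ i, v (algebraMap R K (f i)) := Finset.sum_nonneg fun i _ => hvf i
  rw [div_lt_iff₀ hl] at hN
  obtain ⟨t, ht⟩ : ∃ t, t = N * F.lam ⟨0, hd⟩ := ⟨_, rfl⟩
  rw [← ht] at hN
  have ht0 : 0 < t := by linarith
  set p : Fin r → ℕ := fun i => ⌊t / ν i (algebraMap R K (f i))⌋₊ + 1 with hp
  set Y : R := ∏ i, f i ^ p i with hYdef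
  have hY : Y ≠ 0 := Finset.prod_ne_zero_iff.2 fun i _ => pow_ne_zero _ (hf0 i)
  have hY' : algebraMap R K Y ≠ 0 := algebraMap_ne hY
  have hval : ∀ μ : RVal R K, μ (algebraMap R K Y) = ∑ i, p i * μ (algebraMap R K (f i)) := by
    intro μ
    rw [hYdef, map_prod, μ.map_prod _ _ fun i _ => by
      rw [map_pow]; exact pow_ne_zero _ (hf0' i)]
    exact Finset.sum_congr rfl fun i _ => by rw [map_pow, μ.map_pow (hf0' i)]
  have hνY : ∀ i, t < ν i (algebraMap R K Y) := by
    intro i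
    rw [hval]
    refine lt_of_lt_of_le ?_ (Finset.single_le_sum
      (f := fun j => (p j : ℝ) * ν i (algebraMap R K (f j)))
      (fun j _ => mul_nonneg (Nat.cast_nonneg _) ((ν i).nonneg' _ (hf0' j))) (Finset.mem_univ i))
    rw [← div_lt_iff₀ (hα i), hp]
    exact_mod_cast Nat.lt_floor_add_one _
  have hvY : v (algebraMap R K Y) ≤ t / 2 := by
    rw [hval]
    have h1 : ∀ i, (p i : ℝ) * v (algebraMap R K (f i))
        ≤ t / (4 * (r + 1)) + v (algebraMap R K (f i)) := by
      intro i
      have h2 : (p i : ℝ) ≤ t / ν i (algebraMap R K (f i)) + 1 := by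
        rw [hp]
        push_cast
        have := Nat.floor_le (div_nonneg ht0.le (hα i).le)
        linarith
      have h3 : t / ν i (algebraMap R K (f i)) * v (algebraMap R K (f i)) ≤ t / (4 * (r + 1)) := by
        rw [div_mul_eq_mul_div, div_le_div_iff₀ (hα i) (by positivity), mul_assoc]
        refine mul_le_mul_of_nonneg_left ?_ ht0.le
        rw [mul_comm]
        exact (hf i).le
      calc (p i : ℝ) * v (algebraMap R K (f i))
          ≤ (t / ν i (algebraMap R K (f i)) + 1) * v (algebraMap R K (f i)) :=
            mul_le_mul_of_nonneg_right h2 (hvf i)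
        _ ≤ _ := by rw [add_mul, one_mul]; linarith
    refine (Finset.sum_le_sum fun i _ => h1 i).trans ?_
    rw [Finset.sum_add_distrib, Finset.sum_const, Finset.card_univ, Fintype.card_fin, nsmul_eq_mul]
    have h4 : (r : ℝ) * (t / (4 * (r + 1))) ≤ t / 4 := by
      rw [mul_div_assoc', div_le_div_iff₀ (by positivity) (by norm_num)]
      nlinarith
    linarith
  have hwt : F.wt (Pi.single ⟨0, hd⟩ N) = t := by rw [wt_single, ht]
  rcases F.exists_compat_or_rel (K := K) hY (t := t) hwt.ge with ⟨V, hV, hz⟩ | ⟨h, c, hrel⟩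
  · obtain ⟨μ, hμ, hμV⟩ := hV.exists_exact hd hdim
    have hm : algebraMap R K (mono F.x (Pi.single ⟨0, hd⟩ N)) ≠ 0 :=
      algebraMap_ne (mono_ne_zero F.x_ne _)
    have h1 := hμV _ hz (div_ne_zero hm hY')
    rw [μ.map_div hm hY', hμ.mono_eq, hwt] at h1
    obtain ⟨i, hi⟩ := hall μ hμ
    have h2 := hνY i
    rw [← hi _ hY'] at h2
    linarith
  · exact colen_ideal_le_of_rel hv hY ht0 hrel hvY

end Frame

end Selection

section Counting

/-- A semigroup of nonnegative reals of growth of order at most `d` which contains `d` rationally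
independent elements. -/
structure LatticeSemigroup (d : ℕ) where
  /-- the underlying monoid -/
  S : AddSubmonoid ℝ
  nonneg : ∀ s ∈ S, 0 ≤ s
  /-- the independent elements -/
  lam : Fin d → ℝ
  lam_mem : ∀ i, lam i ∈ S
  indep : ∀ e : Fin d → ℤ, ∑ i, e i * lam i = 0 → e = 0
  /-- the growth constant -/
  c : ℝ
  finite : ∀ s, ((S : Set ℝ) ∩ Set.Iio s).Finite
  card_le : ∀ s, 0 ≤ s → (((S : Set ℝ) ∩ Set.Iio s).ncard : ℝ) ≤ c * (s + 1) ^ d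

namespace LatticeSemigroup

variable {d : ℕ} (G : LatticeSemigroup d)

/-- Integral combinations of the independent elements. -/
def comb : (Fin d → ℤ) →+ ℝ where
  toFun e := ∑ i, e i * G.lam i
  map_zero' := by simp
  map_add' a b := by simp [add_mul, Finset.sum_add_distrib]

/-- The lattice spanned by the independent elements. -/
def lattice : AddSubgroup ℝ := G.comb.range

/-- The sum of the independent elements. -/
def total : ℝ := ∑ i, G.lam i

theorem total_nonneg : 0 ≤ G.total := Finset.sum_nonneg fun i _ => G.nonneg _ (G.lam_mem i)

/-- The boxes in `ℕ ^ d`. -/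
def box (d k : ℕ) : Finset (Fin d → ℕ) := Fintype.piFinset fun _ => Finset.range k

theorem card_box (k : ℕ) : (box d k).card = k ^ d := by simp [box]

theorem lt_of_mem_box {k : ℕ} {a : Fin d → ℕ} (ha : a ∈ box d k) (i : Fin d) : a i < k :=
  Finset.mem_range.1 (Fintype.mem_piFinset.1 ha i)

variable {G}

theorem injOn_combination {S₀ X : Finset ℝ}
    (hS₀ : Set.InjOn (QuotientAddGroup.mk : ℝ → ℝ ⧸ G.lattice) S₀) {σ : ℝ ⧸ G.lattice}
    (hX : ∀ γ ∈ X, (γ : ℝ ⧸ G.lattice) = σ) {k : ℕ} (hk : 0 < k) :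
    Set.InjOn (fun p : ℝ × ℝ × (Fin d → ℕ) => k * p.1 + p.2.1 + G.comb fun i => (p.2.2 i : ℤ))
      (X ×ˢ S₀ ×ˢ box d k : Finset (ℝ × ℝ × (Fin d → ℕ))) := by
  rintro ⟨γ, s, a⟩ h ⟨γ', s', a'⟩ h' heq
  simp only [Finset.coe_product, Set.mem_prod, Finset.mem_coe] at h h' heq
  have hmk : ∀ e, ((G.comb e : ℝ) : ℝ ⧸ G.lattice) = 0 := fun e =>
    (QuotientAddGroup.eq_zero_iff _).2 ⟨e, rfl⟩
  have hkγ : ∀ γ : ℝ, (((k : ℝ) * γ : ℝ) : ℝ ⧸ G.lattice) = k • (γ : ℝ ⧸ G.lattice) := fun γ => by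
    rw [← nsmul_eq_mul]; rfl
  have h1 := congrArg (QuotientAddGroup.mk : ℝ → ℝ ⧸ G.lattice) heq
  rw [QuotientAddGroup.mk_add, QuotientAddGroup.mk_add, QuotientAddGroup.mk_add,
    QuotientAddGroup.mk_add, hmk, hmk, hkγ, hkγ, hX _ h.1, hX _ h'.1, add_zero, add_zero] at h1
  have hs : s = s' := hS₀ h.2.1 h'.2.1 (add_left_cancel h1)
  subst hs
  obtain ⟨e, he⟩ : ∃ e, G.comb e = γ - γ' := by
    have : ((γ - γ' : ℝ) : ℝ ⧸ G.lattice) = 0 := by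
      rw [QuotientAddGroup.mk_sub, hX _ h.1, hX _ h'.1, sub_self]
    exact (QuotientAddGroup.eq_zero_iff _).1 this
  have h2 : G.comb (k • e + ((fun i => (a i : ℤ)) - fun i => (a' i : ℤ))) = 0 := by
    rw [map_add, map_sub, map_nsmul, he, nsmul_eq_mul]
    linarith
  have h3 := G.indep _ h2
  have h4 : ∀ i, a i = a' i ∧ e i = 0 := fun i => by
    have h5 := congrFun h3 i
    simp only [Pi.add_apply, Pi.sub_apply, Pi.smul_apply, Pi.zero_apply] at h5
    rw [nsmul_eq_mul] at h5
    have h6 := lt_of_mem_box h.2.2 i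
    have h7 := lt_of_mem_box h'.2.2 i
    have h8 : e i = 0 := by
      by_contra hne
      rcases lt_or_gt_of_ne hne with hlt | hlt
      · have : (k : ℤ) * e i ≤ k * (-1) := by gcongr; omega
        omega
      · have : (k : ℤ) * 1 ≤ k * e i := by gcongr; omega
        omega
    rw [h8] at h5
    exact ⟨by omega, h8⟩
  have he0 : e = 0 := funext fun i => (h4 i).2
  rw [he0, map_zero] at he
  have h9 : γ = γ' := by linarith
  have h10 : a = a' := funext fun i => (h4 i).1
  rw [h9, h10]

theorem comb_mem (a : Fin d → ℕ) : (G.comb fun i => (a i : ℤ)) ∈ G.S := by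
  change (∑ i, ((a i : ℤ) : ℝ) * G.lam i) ∈ G.S
  refine G.S.sum_mem fun i _ => ?_
  have := G.S.nsmul_mem (G.lam_mem i) (a i)
  simpa using this

theorem comb_le {k : ℕ} {a : Fin d → ℕ} (ha : a ∈ box d k) :
    (G.comb fun i => (a i : ℤ)) ≤ k * G.total := by
  change ∑ i, ((a i : ℤ) : ℝ) * G.lam i ≤ k * ∑ i, G.lam i
  rw [Finset.mul_sum]
  refine Finset.sum_le_sum fun i _ => ?_
  have h1 : ((a i : ℤ) : ℝ) ≤ k := by exact_mod_cast (lt_of_mem_box ha i).le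
  have := G.nonneg _ (G.lam_mem i)
  gcongr

theorem card_mul_card_mul_le {S₀ X : Finset ℝ}
    (hS₀ : Set.InjOn (QuotientAddGroup.mk : ℝ → ℝ ⧸ G.lattice) S₀) {σ : ℝ ⧸ G.lattice}
    (hX : ∀ γ ∈ X, (γ : ℝ ⧸ G.lattice) = σ) {k : ℕ} (hk : 0 < k) {x m : ℝ}
    (hXx : ∀ γ ∈ X, γ < x) (hm : ∀ s ∈ S₀, s ≤ m) {T : Set ℝ} (hTS : T ⊆ G.S)
    (hT : ∀ γ ∈ X, ∀ s ∈ S₀, ∀ a ∈ box d k, k * γ + s + (G.comb fun i => (a i : ℤ)) ∈ T) :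
    X.card * (S₀.card * k ^ d) ≤ (T ∩ Set.Iio (k * x + m + k * G.total)).ncard := by
  have h1 := (injOn_combination hS₀ hX hk).ncard_image
  rw [Set.ncard_coe_finset, Finset.card_product, Finset.card_product, card_box] at h1
  rw [← h1]
  refine Set.ncard_le_ncard ?_ ((G.finite _).subset (Set.inter_subset_inter_left _ hTS))
  rintro _ ⟨⟨γ, s, a⟩, h, rfl⟩
  simp only [Finset.coe_product, Set.mem_prod, Finset.mem_coe] at h
  refine ⟨hT _ h.1 _ h.2.1 _ h.2.2, ?_⟩
  have h2 := G.comb_le h.2.2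
  have h3 := hm _ h.2.1
  have h4 : (k : ℝ) * γ < k * x := mul_lt_mul_of_pos_left (hXx _ h.1) (by exact_mod_cast hk)
  simp only [Set.mem_Iio]
  linarith

variable (G) in
theorem exists_representatives : ∃ S₀ : Finset ℝ, (∀ s ∈ S₀, s ∈ G.S) ∧
    Set.InjOn (QuotientAddGroup.mk : ℝ → ℝ ⧸ G.lattice) S₀ ∧
    ∀ s ∈ G.S, ∃ s' ∈ S₀, (s' : ℝ ⧸ G.lattice) = s := by
  obtain ⟨S₁, hS₁, hbij⟩ := (G.S : Set ℝ).exists_subset_bijOn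
    (QuotientAddGroup.mk : ℝ → ℝ ⧸ G.lattice)
  have hfin : S₁.Finite := by
    by_contra hinf
    obtain ⟨N, hN⟩ := exists_nat_gt (G.c * (2 + G.total) ^ d)
    obtain ⟨P, hP, hcard⟩ := Set.Infinite.exists_subset_card_eq hinf N
    obtain ⟨m, hm⟩ := P.finite_toSet.bddAbove
    obtain ⟨k, hk⟩ := exists_nat_ge (max 1 (m + 2))
    have hk1 : (1 : ℝ) ≤ k := (le_max_left _ _).trans hk
    have hk2 : m + 2 ≤ k := (le_max_right _ _).trans hk
    have hk0 : 0 < k := by exact_mod_cast hk1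
    have h1 := card_mul_card_mul_le (G := G) (S₀ := P) (X := {0}) (σ := 0)
      (hbij.injOn.mono hP) (by simp) hk0 (x := 1 / k) (m := k - 2) (T := G.S)
      (fun γ hγ => by rw [Finset.mem_singleton.1 hγ]; positivity)
      (fun s hs => (hm hs).trans (by linarith)) le_rfl
      (fun γ hγ s hs a _ => by
        rw [Finset.mem_singleton.1 hγ, mul_zero, zero_add]
        exact G.S.add_mem (hS₁ (hP hs)) (comb_mem a))
    rw [Finset.card_singleton, one_mul, hcard] at h1
    have hx : (k : ℝ) * (1 / k) + (k - 2) + k * G.total = k * (1 + G.total) - 1 := by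
      field_simp; ring
    rw [hx] at h1
    have h0 := mul_nonneg (Nat.cast_nonneg (α := ℝ) k) G.total_nonneg
    have h2 := G.card_le (k * (1 + G.total) - 1) (by linarith)
    have h3 : (N : ℝ) * k ^ d ≤ G.c * (1 + G.total) ^ d * k ^ d := by
      refine le_trans (by exact_mod_cast h1) (h2.trans (le_of_eq ?_))
      rw [sub_add_cancel, mul_pow]; ring
    have h4 := le_of_mul_le_mul_right h3 (by positivity)
    have h5 : 0 ≤ G.c := by
      have := G.card_le 0 le_rfl
      simp only [zero_add, one_pow, mul_one] at this
      exact (Nat.cast_nonneg _).trans this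
    have h6 : G.c * (1 + G.total) ^ d ≤ G.c * (2 + G.total) ^ d := by
      have := G.total_nonneg
      gcongr; linarith
    linarith
  refine ⟨hfin.toFinset, fun s hs => hS₁ (hfin.mem_toFinset.1 hs), by simpa using hbij.injOn,
    fun s hs => ?_⟩
  obtain ⟨s', hs', h⟩ := hbij.surjOn ⟨s, hs, rfl⟩
  exact ⟨s', hfin.mem_toFinset.2 hs', h⟩

variable (G) in
/-- A graded family of ideals of a semigroup. -/
structure GradedFamily where
  /-- the members -/
  T : ℕ → Set ℝ
  subset : ∀ n, T n ⊆ G.S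
  add_mem : ∀ {m n x y}, x ∈ T m → y ∈ T n → x + y ∈ T (m + n)
  add_mem_right : ∀ {n x y}, x ∈ T n → y ∈ G.S → x + y ∈ T n
  anti : Antitone T

namespace GradedFamily

/-- The constant family. -/
def const : GradedFamily G where
  T _ := G.S
  subset _ := le_rfl
  add_mem := G.S.add_mem
  add_mem_right := G.S.add_mem
  anti _ _ _ := le_rfl

variable (A : GradedFamily G)

/-- The number of elements of the `n`th member below a bound. -/
noncomputable def count (n : ℕ) (x : ℝ) : ℕ := (A.T n ∩ Set.Iio x).ncard

theorem finite (n : ℕ) (x : ℝ) : (A.T n ∩ Set.Iio x).Finite :=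
  (G.finite x).subset (Set.inter_subset_inter_left _ (A.subset n))

theorem count_mono (n : ℕ) {x y : ℝ} (h : x ≤ y) : A.count n x ≤ A.count n y :=
  Set.ncard_le_ncard (Set.inter_subset_inter_right _ (Set.Iio_subset_Iio h)) (A.finite n y)

variable {A} in
theorem nat_mul_mem {M : ℕ} {γ : ℝ} (hγ : γ ∈ A.T M) {k : ℕ} (hk : 0 < k) :
    k * γ ∈ A.T (k * M) := by
  induction k, hk using Nat.le_induction with
  | base => simpa using hγ
  | succ k _ ih =>
    have := A.add_mem ih hγ
    rw [Nat.succ_mul]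
    push_cast
    rwa [add_mul, one_mul]

theorem exists_count_le : ∃ m : ℝ, ∀ (M k n : ℕ) (x : ℝ), 0 < k → n ≤ k * M →
    k ^ d * A.count M x ≤ A.count n (k * x + m + k * G.total) := by
  classical
  obtain ⟨S₀, hS₀, hinj, hsurj⟩ := G.exists_representatives
  obtain ⟨m, hm⟩ := S₀.finite_toSet.bddAbove
  refine ⟨m, fun M k n x hk hn => ?_⟩
  set X := (A.finite M x).toFinset
  have hX : ∀ γ ∈ X, γ ∈ A.T M ∧ γ < x := fun γ hγ => (A.finite M x).mem_toFinset.1 hγ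
  have hcount : A.count M x = X.card := Set.ncard_eq_toFinset_card _ _
  set B : ℝ → Finset ℝ := fun s => X.filter fun γ : ℝ => (γ : ℝ ⧸ G.lattice) = s
  have h1 : ∀ s ∈ S₀, (B s).card * (S₀.card * k ^ d) ≤ A.count n (k * x + m + k * G.total) :=
    fun s hs => card_mul_card_mul_le (X := B s) (σ := (s : ℝ ⧸ G.lattice)) (T := A.T n) hinj
      (fun γ hγ => (Finset.mem_filter.1 hγ).2) hk
      (fun γ hγ => (hX γ (Finset.mem_filter.1 hγ).1).2) (fun s hs => hm hs) (A.subset n)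
      (fun γ hγ s hs a _ => A.add_mem_right (A.add_mem_right
        (A.anti hn (nat_mul_mem (hX γ (Finset.mem_filter.1 hγ).1).1 hk)) (hS₀ s hs)) (comb_mem a))
  have h2 : X.card ≤ ∑ s ∈ S₀, (B s).card := by
    refine le_trans (Finset.card_le_card (t := S₀.biUnion B) fun γ hγ => ?_)
      Finset.card_biUnion_le
    obtain ⟨s, hs, hsγ⟩ := hsurj γ (A.subset M (hX γ hγ).1)
    exact Finset.mem_biUnion.2 ⟨s, hs, Finset.mem_filter.2 ⟨hγ, hsγ.symm⟩⟩
  have h3 : 0 < S₀.card := by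
    obtain ⟨s, hs, -⟩ := hsurj 0 G.S.zero_mem
    exact Finset.card_pos.2 ⟨s, hs⟩
  rw [hcount]
  refine Nat.le_of_mul_le_mul_left ?_ h3
  calc S₀.card * (k ^ d * X.card) = X.card * (S₀.card * k ^ d) := by ring
    _ ≤ (∑ s ∈ S₀, (B s).card) * (S₀.card * k ^ d) := Nat.mul_le_mul_right _ h2
    _ ≤ ∑ s ∈ S₀, A.count n (k * x + m + k * G.total) := by
      rw [Finset.sum_mul]; exact Finset.sum_le_sum h1
    _ = _ := by rw [Finset.sum_const, smul_eq_mul]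

theorem eventually_count_le (C : ℕ) (hC : 0 < C) {M : ℕ} (hM : 0 < M) :
    ∀ᶠ n : ℕ in atTop, (A.count M (C * M - (G.total + 2)) : ℝ) / M ^ d ≤
      A.count n (C * n) / n ^ d := by
  obtain ⟨m, hm⟩ := A.exists_count_le
  obtain ⟨q, hq⟩ := exists_nat_ge m
  filter_upwards [eventually_ge_atTop ((q + C * M + 1) * M)] with n hn
  have hn0 : 0 < n := lt_of_lt_of_le (by positivity) hn
  set k := n / M + 1 with hk
  have h1 : n < k * M := by rw [hk]; exact Nat.lt_mul_of_div_lt (Nat.lt_succ_self _) hM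
  have h2 : (k - 1) * M ≤ n := by rw [hk, Nat.add_sub_cancel]; exact Nat.div_mul_le_self _ _
  have h3 : q + C * M ≤ k := by
    have := (Nat.le_div_iff_mul_le hM).2 hn
    omega
  have h4 := hm M k n (C * M - (G.total + 2)) (Nat.succ_pos _) h1.le
  have h5 : (k : ℝ) * (C * M - (G.total + 2)) + m + k * G.total ≤ C * n := by
    have h6 : ((q : ℝ) + C * M) ≤ k := by exact_mod_cast h3
    have h7 : ((k : ℝ) - 1) * M ≤ n := by
      have : ((k - 1 : ℕ) : ℝ) = (k : ℝ) - 1 := by rw [hk]; simp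
      rw [← this]; exact_mod_cast h2
    have h8 : (C : ℝ) * (((k : ℝ) - 1) * M) ≤ C * n := by gcongr
    have h9 : (0 : ℝ) ≤ C * M := by positivity
    have h10 : (0 : ℝ) ≤ q := by positivity
    linarith
  have h11 := h4.trans (A.count_mono n h5)
  have h12 : (k : ℝ) ^ d * A.count M (C * M - (G.total + 2)) ≤ A.count n (C * n) := by
    exact_mod_cast h11
  rw [div_le_div_iff₀ (by positivity) (by positivity)]
  have h13 : (n : ℝ) ^ d ≤ k ^ d * M ^ d := by
    rw [← mul_pow]
    have : (n : ℝ) ≤ k * M := by exact_mod_cast h1.le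
    gcongr
  calc (A.count M (C * M - (G.total + 2)) : ℝ) * n ^ d
      ≤ A.count M (C * M - (G.total + 2)) * (k ^ d * M ^ d) := by gcongr
    _ = k ^ d * A.count M (C * M - (G.total + 2)) * M ^ d := by ring
    _ ≤ _ := by gcongr

end GradedFamily

end LatticeSemigroup

end Counting

section Limits

theorem exists_tendsto_of_eventually_le {u v : ℕ → ℝ} {B : ℝ} (hB : ∀ᶠ n in atTop, u n ≤ B)
    (h : ∀ M, 0 < M → ∀ᶠ n in atTop, v M ≤ u n) (p : ℕ)
    (hlim : Tendsto (fun M => u M - v (M + p)) atTop (𝓝 0)) :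
    ∃ L, Tendsto u atTop (𝓝 L) := by
  have hv : ∀ M, 0 < M → v M ≤ B := fun M hM => by
    obtain ⟨n, h1, h2⟩ := ((h M hM).and hB).exists
    exact h1.trans h2
  have hbdd : BddAbove (v '' Set.Ioi 0) := ⟨B, by rintro _ ⟨M, hM, rfl⟩; exact hv M hM⟩
  have hne : (v '' Set.Ioi 0).Nonempty := ⟨v 1, 1, by simp, rfl⟩
  refine ⟨sSup (v '' Set.Ioi 0), tendsto_order.2 ⟨fun a ha => ?_, fun a ha => ?_⟩⟩
  · obtain ⟨_, ⟨M, hM, rfl⟩, haM⟩ := exists_lt_of_lt_csSup hne ha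
    filter_upwards [h M hM] with n hn using haM.trans_le hn
  · filter_upwards [(tendsto_order.1 hlim).2 _ (sub_pos.2 ha), eventually_gt_atTop 0] with M hM h0
    have := le_csSup hbdd ⟨M + p, Nat.add_pos_left h0 p, rfl⟩
    linarith

theorem tendsto_natCast_div_natCast_add_pow (p d : ℕ) :
    Tendsto (fun n : ℕ => ((n : ℝ) / ((n + p : ℕ) : ℝ)) ^ d) atTop (𝓝 1) := by
  have := (tendsto_natCast_div_add_atTop (p : ℝ)).pow d
  simpa using this

namespace LatticeSemigroup

variable {d : ℕ} (G : LatticeSemigroup d)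

theorem exists_tendsto_const (C : ℕ) (hC : 0 < C) :
    ∃ g, Tendsto (fun n : ℕ => (((G.S : Set ℝ) ∩ Set.Iio (C * n)).ncard : ℝ) / n ^ d)
      atTop (𝓝 g) := by
  obtain ⟨p, hp⟩ := exists_nat_ge (G.total + 2)
  set K : ℝ → ℝ := fun x => (((G.S : Set ℝ) ∩ Set.Iio x).ncard : ℝ) with hK
  have hKm : Monotone K := fun x y hxy =>
    Nat.cast_le.2 ((GradedFamily.const (G := G)).count_mono 0 hxy)
  have hCp : G.total + 2 ≤ C * p := by
    have : (1 : ℝ) ≤ C := by exact_mod_cast hC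
    nlinarith [G.total_nonneg]
  have h0 : 0 ≤ G.c := by
    have := G.card_le 0 le_rfl
    simp only [zero_add, one_pow, mul_one] at this
    exact (Nat.cast_nonneg _).trans this
  have hbound : ∀ᶠ n : ℕ in atTop, K (C * n) / n ^ d ≤ G.c * (C + 1) ^ d := by
    filter_upwards [eventually_gt_atTop 0] with n hn
    rw [div_le_iff₀ (by positivity)]
    refine (G.card_le (C * n) (by positivity)).trans ?_
    rw [mul_assoc, ← mul_pow]
    have : (1 : ℝ) ≤ n := by exact_mod_cast hn
    have : (C : ℝ) * n + 1 ≤ (C + 1) * n := by linarith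
    gcongr
  refine exists_tendsto_of_eventually_le hbound
    (v := fun M => K (C * M - C * p) / M ^ d) (fun M hM => ?_) p ?_
  · filter_upwards [(GradedFamily.const (G := G)).eventually_count_le C hC hM] with n hn
    refine le_trans ?_ hn
    have : K (C * M - C * p) ≤ K (C * M - (G.total + 2)) := hKm (by linarith)
    exact div_le_div_of_nonneg_right this (by positivity)
  · have h1 : Tendsto (fun n : ℕ => G.c * (C + 1) ^ d *
        (1 - ((n : ℝ) / ((n + p : ℕ) : ℝ)) ^ d)) atTop (𝓝 0) := by
      have := ((tendsto_natCast_div_natCast_add_pow p d).const_sub 1).const_mul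
        (G.c * (C + 1) ^ d)
      simpa using this
    have h2 : ∀ᶠ n : ℕ in atTop, K (C * n) / n ^ d - K (C * (n + p : ℕ) - C * p) / (n + p : ℕ) ^ d
        = K (C * n) / n ^ d * (1 - ((n : ℝ) / ((n + p : ℕ) : ℝ)) ^ d) := by
      filter_upwards [eventually_gt_atTop 0] with n hn
      have h3 : (C : ℝ) * (n + p : ℕ) - C * p = C * n := by push_cast; ring
      have h4 : (0 : ℝ) < (n + p : ℕ) := by positivity
      rw [h3, div_pow]
      field_simp
    refine squeeze_zero' ?_ ?_ h1
    · filter_upwards [h2] with n hn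
      rw [hn]
      refine mul_nonneg (by positivity) (sub_nonneg.2 (pow_le_one₀ (by positivity) ?_))
      exact div_le_one_of_le₀ (by push_cast; linarith [Nat.cast_nonneg (α := ℝ) p]) (by positivity)
    · filter_upwards [h2, hbound] with n hn hb
      rw [hn]
      refine mul_le_mul_of_nonneg_right hb (sub_nonneg.2 (pow_le_one₀ (by positivity) ?_))
      exact div_le_one_of_le₀ (by push_cast; linarith [Nat.cast_nonneg (α := ℝ) p]) (by positivity)

namespace GradedFamily

variable {G} (A : GradedFamily G)

theorem count_add_le (n : ℕ) {x y : ℝ} (h : y ≤ x) :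
    A.count n x + ((G.S : Set ℝ) ∩ Set.Iio y).ncard ≤
      ((G.S : Set ℝ) ∩ Set.Iio x).ncard + A.count n y := by
  have h1 := Set.ncard_sdiff_add_ncard_of_subset
    (Set.inter_subset_inter_right (A.T n) (Set.Iio_subset_Iio h)) (A.finite n x)
  have h2 := Set.ncard_sdiff_add_ncard_of_subset
    (Set.inter_subset_inter_right (G.S : Set ℝ) (Set.Iio_subset_Iio h)) (G.finite x)
  have h3 : ((A.T n ∩ Set.Iio x) \ (A.T n ∩ Set.Iio y)).ncard ≤
      (((G.S : Set ℝ) ∩ Set.Iio x) \ ((G.S : Set ℝ) ∩ Set.Iio y)).ncard := by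
    refine Set.ncard_le_ncard ?_ ((G.finite x).subset Set.sdiff_subset)
    rintro z ⟨⟨hz, hzx⟩, hzy⟩
    exact ⟨⟨A.subset n hz, hzx⟩, fun h => hzy ⟨hz, h.2⟩⟩
  unfold count
  omega

theorem exists_tendsto_count (C : ℕ) (hC : 0 < C) :
    ∃ L, Tendsto (fun n : ℕ => (A.count n (C * n) : ℝ) / n ^ d) atTop (𝓝 L) := by
  obtain ⟨g, hg⟩ := G.exists_tendsto_const C hC
  obtain ⟨p, hp⟩ := exists_nat_ge (G.total + 2)
  have hCp : G.total + 2 ≤ C * p := by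
    have : (1 : ℝ) ≤ C := by exact_mod_cast hC
    nlinarith [G.total_nonneg]
  set K : ℝ → ℝ := fun x => (((G.S : Set ℝ) ∩ Set.Iio x).ncard : ℝ) with hK
  have hKm : Monotone K := fun x y hxy =>
    Nat.cast_le.2 ((GradedFamily.const (G := G)).count_mono 0 hxy)
  have h1 : Tendsto (fun n : ℕ => K (C * n - C * p) / n ^ d) atTop (𝓝 g) := by
    rw [← tendsto_add_atTop_iff_nat p]
    have h2 := hg.mul (tendsto_natCast_div_natCast_add_pow p d)
    rw [mul_one] at h2
    refine h2.congr' ?_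
    filter_upwards [eventually_gt_atTop 0] with n hn
    have h3 : (C : ℝ) * (n + p : ℕ) - C * p = C * n := by push_cast; ring
    have h4 : (0 : ℝ) < (n + p : ℕ) := by positivity
    rw [h3, div_pow]
    field_simp
    rfl
  have hle : ∀ n, (A.count n (C * n) : ℝ) ≤ K (C * n) := fun n =>
    Nat.cast_le.2 (Set.ncard_le_ncard (Set.inter_subset_inter_left _ (A.subset n)) (G.finite _))
  have hbound : ∀ᶠ n : ℕ in atTop, (A.count n (C * n) : ℝ) / n ^ d ≤ g + 1 := by
    filter_upwards [(tendsto_order.1 hg).2 (g + 1) (by linarith)] with n hn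
    exact (div_le_div_of_nonneg_right (hle n) (by positivity)).trans hn.le
  refine exists_tendsto_of_eventually_le hbound
    (fun M hM => A.eventually_count_le C hC hM) 0 ?_
  have h2 := hg.sub h1
  rw [sub_self] at h2
  refine squeeze_zero (fun n => ?_) (fun n => ?_) h2
  · rw [add_zero, sub_nonneg]
    have : A.count n (C * n - (G.total + 2)) ≤ A.count n (C * n) :=
      A.count_mono n (by linarith [G.total_nonneg])
    gcongr
  · rw [add_zero, ← sub_div, ← sub_div]
    have h3 := A.count_add_le n (x := C * n) (y := C * n - (G.total + 2))
      (by linarith [G.total_nonneg])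
    have h4 : (A.count n (C * n) : ℝ) + K (C * n - (G.total + 2)) ≤
      K (C * n) + A.count n (C * n - (G.total + 2)) := by
      have h6 := (Nat.cast_le (α := ℝ)).2 h3
      rwa [Nat.cast_add, Nat.cast_add] at h6
    have h5 : K (C * n - C * p) ≤ K (C * n - (G.total + 2)) := hKm (by linarith)
    refine div_le_div_of_nonneg_right ?_ (by positivity)
    change _ ≤ K _ - _
    linarith

theorem exists_tendsto_ncard_sdiff (C : ℕ) (hC : 0 < C)
    (hT : ∀ n : ℕ, ∀ x ∈ G.S, (C : ℝ) * n ≤ x → x ∈ A.T n) :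
    ∃ L, Tendsto (fun n : ℕ => (((G.S : Set ℝ) \ A.T n).ncard : ℝ) / n ^ d) atTop (𝓝 L) := by
  obtain ⟨g, hg⟩ := G.exists_tendsto_const C hC
  obtain ⟨l, hl⟩ := A.exists_tendsto_count C hC
  refine ⟨g - l, (hg.sub hl).congr fun n => ?_⟩
  have h1 := Set.ncard_sdiff_add_ncard_of_subset
    (Set.inter_subset_inter_left (Set.Iio ((C : ℝ) * n)) (A.subset n)) (G.finite _)
  have h2 : ((G.S : Set ℝ) ∩ Set.Iio (C * n)) \ (A.T n ∩ Set.Iio (C * n)) =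
      (G.S : Set ℝ) \ A.T n := by
    ext x
    refine ⟨fun h => ⟨h.1.1, fun hx => h.2 ⟨hx, h.1.2⟩⟩, fun h => ?_⟩
    exact ⟨⟨h.1, not_le.1 fun hx => h.2 (hT n x h.1 hx)⟩, fun hx => h.2 hx.1⟩
  rw [h2] at h1
  rw [← sub_div, ← h1, count]
  push_cast
  rw [add_sub_cancel_right]

end GradedFamily

end LatticeSemigroup

end Limits

section FrameExistence

theorem exists_intLinearIndependent_le {d : ℕ} (b : Fin d → ℝ) (hb : ∀ i, 0 < b i) :
    ∃ lam : Fin d → ℝ, (∀ i, 0 < lam i ∧ lam i ≤ b i) ∧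
      ∀ e : Fin d → ℤ, ∑ i, e i * lam i = 0 → e = 0 := by
  have hrank : (d : Cardinal) ≤ Module.rank ℚ ℝ := by
    rw [Real.rank_rat_real]
    exact (Cardinal.nat_lt_continuum d).le
  obtain ⟨μ, hμ⟩ := Module.le_rank_iff.1 hrank
  have hq : ∀ i, ∃ q : ℚ, 0 < q * μ i ∧ q * μ i ≤ b i := fun i => by
    rcases lt_or_gt_of_ne (hμ.ne_zero i) with h | h
    · obtain ⟨q, h1, h2⟩ := exists_rat_btwn (div_neg_of_pos_of_neg (hb i) h)
      exact ⟨q, mul_pos_of_neg_of_neg h2 h, ((div_lt_iff_of_neg h).1 h1).le⟩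
    · obtain ⟨q, h1, h2⟩ := exists_rat_btwn (div_pos (hb i) h)
      exact ⟨q, mul_pos h1 h, ((lt_div_iff₀ h).1 h2).le⟩
  choose q hq0 hqb using hq
  refine ⟨fun i => q i * μ i, fun i => ⟨hq0 i, hqb i⟩, fun e he => funext fun i => ?_⟩
  have h1 := Fintype.linearIndependent_iff.1 hμ (fun i => e i * q i) (by
    rw [← he]
    exact Finset.sum_congr rfl fun i _ => by rw [Rat.smul_def]; push_cast; ring) i
  have h2 : q i ≠ 0 := fun h => (hq0 i).ne' (by simp [h])
  exact_mod_cast (mul_eq_zero.1 h1).resolve_right h2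

theorem exists_frame {R : Type*} [CommRing R] [IsDomain R] [IsLocalRing R] [IsNoetherianRing R]
    {d : ℕ} (hd : 0 < d) (hdim : ringKrullDim R = d) (b : R → ℝ)
    (hb : ∀ x ∈ maximalIdeal R, x ≠ 0 → 0 < b x) :
    ∃ F : Frame R d, ∀ i, F.lam i ≤ b (F.x i) := by
  classical
  obtain ⟨y, hy, s, hs⟩ := exists_system_of_parameters R hdim
  have hne : maximalIdeal R ≠ ⊥ := fun h => by
    have := ringKrullDim_eq_zero_of_isField (isField_iff_maximalIdeal_eq.2 h)
    rw [hdim] at this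
    exact hd.ne' (by exact_mod_cast this)
  obtain ⟨z, hz, hz0⟩ := Submodule.exists_mem_ne_zero_of_ne_bot hne
  set x : Fin d → R := fun i => if y i = 0 then z else y i with hx
  have hx0 : ∀ i, x i ≠ 0 := fun i => by
    by_cases h : y i = 0 <;> simp [hx, h, hz0]
  have hxm : ∀ i, x i ∈ maximalIdeal R := fun i => by
    by_cases h : y i = 0
    · simpa [hx, h] using hz
    · simpa [hx, h] using hy i
  obtain ⟨lam, hlam, hind⟩ := exists_intLinearIndependent_le (fun i => b (x i))
    fun i => hb _ (hxm i) (hx0 i)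
  have : Nonempty (Fin d) := ⟨⟨0, hd⟩⟩
  refine ⟨⟨x, lam, hx0, hind, s, hs.trans (Ideal.span_le.2 ?_),
    Finset.univ.inf' Finset.univ_nonempty lam, ?_, fun i => Finset.inf'_le _ (Finset.mem_univ i)⟩,
    fun i => (hlam i).2⟩
  · rintro _ ⟨i, rfl⟩
    by_cases h : y i = 0
    · rw [h]; exact Ideal.zero_mem _
    · exact Ideal.subset_span ⟨i, by simp [hx, h]⟩
  · exact (Finset.lt_inf'_iff _).2 fun i _ => (hlam i).1

end FrameExistence

section Growth

namespace RVal

variable {R K : Type*} [CommRing R] [Field K] [Algebra R K] (v : RVal R K)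

theorem values_sdiff_ideal [IsFractionRing R K] (t : ℝ) :
    v.values ⊤ \ v.values (v.ideal t) = v.values (⊤ : Ideal R) ∩ Set.Iio t := by
  ext s
  constructor
  · rintro ⟨⟨f, hf, hf0, rfl⟩, hs⟩
    refine ⟨⟨f, hf, hf0, rfl⟩, ?_⟩
    by_contra h
    exact hs ⟨f, fun _ => not_lt.1 h, hf0, rfl⟩
  · rintro ⟨hs, hst⟩
    refine ⟨hs, ?_⟩
    rintro ⟨f, hf, hf0, rfl⟩
    exact not_le.2 hst (hf (algebraMap_ne hf0))

theorem add_mem_values [IsDomain R] [IsFractionRing R K] {I J L : Ideal R}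
    (h : ∀ f ∈ I, ∀ g ∈ J, f * g ∈ L) {s t : ℝ} (hs : s ∈ v.values I) (ht : t ∈ v.values J) :
    s + t ∈ v.values L := by
  obtain ⟨f, hf, hf0, rfl⟩ := hs
  obtain ⟨g, hg, hg0, rfl⟩ := ht
  exact ⟨f * g, h f hf g hg, mul_ne_zero hf0 hg0, by
    rw [_root_.map_mul, v.map_mul (algebraMap_ne hf0) (algebraMap_ne hg0)]⟩

end RVal

namespace Frame

theorem Adapted.pos {R K : Type*} [CommRing R] [IsLocalRing R] [Field K] [Algebra R K]
    [IsFractionRing R K] {d : ℕ} {F : Frame R d} {v : RVal R K} (h : F.Adapted v) (y : R)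
    (hy : y ∈ maximalIdeal R) (hy0 : y ≠ 0) : 0 < v (algebraMap R K y) :=
  h.maximalIdeal_le hy (algebraMap_ne hy0)

variable {R K : Type*} [CommRing R] [IsDomain R] [IsLocalRing R] [IsNoetherianRing R] [Field K]
  [Algebra R K] [IsFractionRing R K] {d : ℕ} {F : Frame R d}

theorem Adapted.colen_ideal {v : RVal R K} (h : F.Adapted v) (hleaf : v.Leaf) (t : ℝ) :
    (v.ideal t).colen = (v.values ⊤ ∩ Set.Iio t).encard := by
  rw [v.colen_eq_encard hleaf h.pos (h.colen_ideal_ne_top t) le_rfl, v.values_sdiff_ideal]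

theorem Adapted.ncard_le {v : RVal R K} (h : F.Adapted v) (hleaf : v.Leaf) {t : ℝ} (ht : 0 ≤ t) :
    ((v.values ⊤ ∩ Set.Iio t).ncard : ℝ) ≤
      (F.J.colen.toNat * (1 / F.δ + 1) ^ d) * (t + 1) ^ d := by
  have hδ := F.δ_pos
  set q := ⌈t / F.δ⌉₊ with hq
  have h1 : t ≤ q * F.δ := (div_le_iff₀ F.δ_pos).1 (Nat.le_ceil _)
  have h2 := (Ideal.colen_anti (h.pow_le h1)).trans (F.colen_J_pow_le q)
  rw [h.colen_ideal hleaf, ← (v.finite_values (h.colen_ideal_ne_top t)).cast_ncard_eq] at h2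
  have h3 : (v.values ⊤ ∩ Set.Iio t).ncard ≤ q ^ d * F.J.colen.toNat := by exact_mod_cast h2
  have h4 : (q : ℝ) ≤ (1 / F.δ + 1) * (t + 1) := by
    have h5 := (Nat.ceil_lt_add_one (div_nonneg ht hδ.le)).le
    have h6 : (1 / F.δ + 1) * (t + 1) = t / F.δ + 1 + (1 / F.δ + t) := by ring
    have : 0 ≤ 1 / F.δ + t := by positivity
    linarith
  calc ((v.values ⊤ ∩ Set.Iio t).ncard : ℝ) ≤ (q : ℝ) ^ d * F.J.colen.toNat := by exact_mod_cast h3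
    _ ≤ ((1 / F.δ + 1) * (t + 1)) ^ d * F.J.colen.toNat := by gcongr
    _ = _ := by rw [mul_pow]; ring

/-- The semigroup of values of a valuation with prescribed values on a frame. -/
noncomputable def Exact.latticeSemigroup {v : RVal R K} (h : F.Exact v) (hleaf : v.Leaf) :
    LatticeSemigroup d where
  S :=
    { carrier := v.values ⊤
      zero_mem' := ⟨1, trivial, one_ne_zero, by rw [_root_.map_one, v.map_one]⟩
      add_mem' := v.add_mem_values fun _ _ _ _ => Submodule.mem_top }
  nonneg := by
    rintro _ ⟨f, -, hf, rfl⟩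
    exact v.nonneg' f (algebraMap_ne hf)
  lam := F.lam
  lam_mem i := ⟨F.x i, trivial, F.x_ne i, h i⟩
  indep := F.indep
  c := F.J.colen.toNat * (1 / F.δ + 1) ^ d
  finite t := v.finite_values (h.adapted.colen_ideal_ne_top t)
  card_le _ ht := h.adapted.ncard_le hleaf ht

/-- The values of one valuation on the valuation ideals of another one. -/
def Exact.gradedFamily {v : RVal R K} (h : F.Exact v) (hleaf : v.Leaf) (w : RVal R K) :
    (h.latticeSemigroup hleaf).GradedFamily where
  T n := v.values (w.ideal n)
  subset _ := v.values_mono le_top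
  add_mem := v.add_mem_values fun f hf g hg => by
    rw [w.mem_ideal, _root_.map_mul, Nat.cast_add]
    exact hf.mul hg
  add_mem_right := v.add_mem_values fun _ hf g _ => Ideal.mul_mem_right g _ hf
  anti _ _ hmn := v.values_mono (w.ideal_le_ideal (Nat.cast_le.2 hmn))

theorem Adapted.exists_tendsto_colen [IsAlgClosed (ResidueField R)] (hd : 0 < d)
    (hdim : ringKrullDim R = d) {v : RVal R K} (hv : F.Adapted v) :
    ∃ L : ℝ, Tendsto (fun n : ℕ => ((v.ideal n).colen.toNat : ℝ) / n ^ d) atTop (𝓝 L) := by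
  obtain ⟨ν, hν, C, hC, hle⟩ | ⟨C, hC⟩ := F.exists_exact_le_or_colen_le hd hdim hv
  · obtain ⟨N, hN⟩ := exists_nat_ge C
    have hN0 : 0 < N := by exact_mod_cast hC.trans_le hN
    have hleaf : ν.Leaf := hν.leaf
    have hI : ∀ n : ℕ, ν.ideal (N * n) ≤ v.ideal n := fun n f hf hf0 => by
      have h1 : f ≠ 0 := fun h => hf0 (by rw [h, _root_.map_zero])
      have h2 := (hf hf0).trans (hle f h1)
      have h3 : C * v (algebraMap R K f) ≤ N * v (algebraMap R K f) :=
        mul_le_mul_of_nonneg_right hN (v.nonneg' f hf0)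
      exact le_of_mul_le_mul_left (h2.trans h3) (by exact_mod_cast hN0)
    obtain ⟨L, hL⟩ := (hν.gradedFamily hleaf v).exists_tendsto_ncard_sdiff N hN0
      (by
        rintro n _ ⟨f, -, hf0, rfl⟩ hx
        exact ⟨f, hI n fun _ => hx, hf0, rfl⟩)
    refine ⟨L, hL.congr fun n => ?_⟩
    rw [ν.colen_eq_encard hleaf hν.adapted.pos (hν.adapted.colen_ideal_ne_top _) (hI n)]
    rfl
  · refine ⟨0, squeeze_zero' (.of_forall fun n => by positivity) ?_
      (?_ : Tendsto (fun n : ℕ => (C * 2 ^ (d - 1) : ℝ) / n) atTop (𝓝 0))⟩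
    · filter_upwards [eventually_gt_atTop 0] with n hn
      have h1 : (v.ideal n).colen.toNat ≤ C * (n + 1) ^ (d - 1) :=
        ENat.toNat_le_of_le_natCast (hC n)
      have h2 : ((v.ideal n).colen.toNat : ℝ) ≤ C * (n + 1) ^ (d - 1) := by exact_mod_cast h1
      have h3 : (1 : ℝ) ≤ n := by exact_mod_cast hn
      rw [div_le_div_iff₀ (by positivity) (by positivity)]
      calc ((v.ideal n).colen.toNat : ℝ) * n ≤ C * (n + 1) ^ (d - 1) * n := by gcongr
        _ ≤ C * (2 * n) ^ (d - 1) * n := by gcongr; linarith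
        _ = C * 2 ^ (d - 1) * n ^ (d - 1 + 1) := by rw [mul_pow, pow_succ]; ring
        _ = _ := by rw [Nat.sub_add_cancel hd]
    · exact tendsto_const_div_atTop_nhds_zero_nat _

end Frame

end Growth

theorem valuation_semigroup_growth
    {R : Type*} [CommRing R] [IsDomain R] [IsLocalRing R] [IsNoetherianRing R]
    -- R is regular, or analytically unramified
    (hR : IsRegularLocalRing' R ∨ IsReduced (AdicCompletion (maximalIdeal R) R))
    -- the residue field of R is algebraically closed
    (hac : IsAlgClosed (ResidueField R))
    (d : ℕ) (hd : 0 < d) (hdim : ringKrullDim R = d)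
    -- ω is a rank one valuation of the quotient field of R, written additively,
    -- with value group contained in ℝ
    (ω : FractionRing R → ℝ)
    (hωmul : ∀ x y : FractionRing R, x ≠ 0 → y ≠ 0 → ω (x * y) = ω x + ω y)
    (hωadd : ∀ x y : FractionRing R, x ≠ 0 → y ≠ 0 → x + y ≠ 0 →
      min (ω x) (ω y) ≤ ω (x + y))
    -- ω dominates R
    (hdom : ∀ r : R, r ≠ 0 → 0 ≤ ω (algebraMap R (FractionRing R) r))
    (hcenter : ∀ r : R, r ≠ 0 →
      (r ∈ maximalIdeal R ↔ 0 < ω (algebraMap R (FractionRing R) r)))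
    -- ω is zero dimensional: the residue field of the valuation ring of ω is
    -- algebraic over R/m_R
    (hzerodim : ∀ x : FractionRing R, (x = 0 ∨ 0 ≤ ω x) →
      ∃ p : Polynomial R, (∃ i : ℕ, p.coeff i ∉ maximalIdeal R) ∧
        (Polynomial.aeval x p = 0 ∨ 0 < ω (Polynomial.aeval x p))) :
    -- then, with S^R(ω) the semigroup of positive values of ω on R and
    -- φ(n) = #(S^R(ω) ∩ (0,n)), the limit of φ(n)/n^d exists
    ∃ L : ℝ,
      Tendsto
        (fun n : ℕ =>
          (Nat.card
            ({t : ℝ | ∃ f : R, f ≠ 0 ∧ ω (algebraMap R (FractionRing R) f) = t ∧ 0 < t}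
              ∩ Set.Ioo (0 : ℝ) (n : ℝ) : Set ℝ) : ℝ) / (n : ℝ) ^ d)
        atTop (𝓝 L) := by
  let v : RVal R (FractionRing R) :=
    { toFun := ω
      map_mul' := hωmul
      map_add' := hωadd
      nonneg' := fun r hr => hdom r fun h => hr (by rw [h, map_zero]) }
  have hne : ∀ {r : R}, algebraMap R (FractionRing R) r ≠ 0 → r ≠ 0 := fun hr h =>
    hr (by rw [h, map_zero])
  obtain ⟨F, hF⟩ := exists_frame hd hdim (fun x => ω (algebraMap R (FractionRing R) x))
    fun x hx hx0 => (hcenter x hx0).1 hx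
  have hFv : F.Adapted v := hF
  have hleaf : v.Leaf := v.leaf_of_forall hFv.maximalIdeal_le fun f g hf hg hfg => by
    have hval : ω (algebraMap R (FractionRing R) f / algebraMap R (FractionRing R) g) = 0 :=
      (v.map_div (algebraMap_ne hf) (algebraMap_ne hg)).trans (sub_eq_zero.2 hfg)
    obtain ⟨p, hp, hpx⟩ := hzerodim _ (Or.inr hval.ge)
    exact ⟨p, hp, fun h0 => hpx.resolve_left h0⟩
  obtain ⟨L, hL⟩ := hFv.exists_tendsto_colen hd hdim
  have hcard : ∀ n : ℕ, 0 < n → (v.ideal n).colen.toNat =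
      Nat.card ({t : ℝ | ∃ f : R, f ≠ 0 ∧ ω (algebraMap R (FractionRing R) f) = t ∧ 0 < t}
        ∩ Set.Ioo (0 : ℝ) (n : ℝ) : Set ℝ) + 1 := fun n hn => by
    have hset : v.values (⊤ : Ideal R) ∩ Set.Iio (n : ℝ) = insert 0
        ({t : ℝ | ∃ f : R, f ≠ 0 ∧ ω (algebraMap R (FractionRing R) f) = t ∧ 0 < t}
          ∩ Set.Ioo (0 : ℝ) (n : ℝ)) := by
      ext t
      constructor
      · rintro ⟨⟨f, -, hf0, rfl⟩, ht⟩
        rcases (hdom f hf0).eq_or_lt with h | h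
        · exact Or.inl h.symm
        · exact Or.inr ⟨⟨f, hf0, rfl, h⟩, h, ht⟩
      · rintro (rfl | ⟨⟨f, hf0, hft, -⟩, -, ht⟩)
        · exact ⟨⟨1, Submodule.mem_top, one_ne_zero, by rw [map_one, v.map_one]⟩,
            Set.mem_Iio.2 (Nat.cast_pos.2 hn)⟩
        · exact ⟨⟨f, Submodule.mem_top, hf0, hft⟩, ht⟩
    have hfin := v.finite_values (hFv.colen_ideal_ne_top n)
    rw [hFv.colen_ideal hleaf, Nat.card_coe_set_eq, ← Set.ncard_insert_of_notMem
      (fun h => lt_irrefl _ h.2.1) ((hset ▸ hfin).subset (Set.subset_insert _ _)), ← hset]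
    rfl
  refine ⟨L, ?_⟩
  have hone : Tendsto (fun n : ℕ => (1 : ℝ) / (n : ℝ) ^ d) atTop (𝓝 0) := by
    have h := (tendsto_one_div_atTop_nhds_zero_nat (𝕜 := ℝ)).pow d
    rw [zero_pow hd.ne'] at h
    exact h.congr fun n => one_div_pow _ _
  have hlim := hL.sub hone
  rw [sub_zero] at hlim
  refine hlim.congr' ?_
  filter_upwards [eventually_gt_atTop 0] with n hn
  rw [hcard n hn, ← sub_div, Nat.cast_add, Nat.cast_one, add_sub_cancel_right]
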